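/- arXiv:1304.4267 — 4 statements merged into one kernel-verified Lean document; each statement's English description precedes it below -/
import Mathlib

section
/- Let φ(R) be a first-order sentence over a signature Σ ∪ {R}, R an n-ary relation symbol, which defines a union-closed property of R: for every Σ-structure M and every family (P_i)_{i∈I} of n-ary relations on dom(M) with (M, P_i) ⊨ φ for all i ∈ I, also (M, ⋃_{i∈I} P_i) ⊨ φ. Then there exists an Inclusion Logic formula φ⁺(x̄) over Σ with free variables x̄ = (x₁,…,xₙ) such that for all Σ-structures M and all teams X over M with domain {x₁,…,xₙ}: M ⊨_X φ⁺(x̄) if and only if (M, X(x̄)) ⊨ φ(R). -/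
open FirstOrder Language Set

namespace TeamSem

/-- The set of variables occurring in a term. -/
def tvars {L : Language} : L.Term ℕ → Set ℕ
  | Term.var v => {v}
  | Term.func _ ts => ⋃ i, tvars (ts i)

/-- Formulas of Inclusion Logic FO(⊆) in negation normal form, over the signature `L`,
with variables from `ℕ`. -/
inductive IncForm (L : Language) where
  | rel {n : ℕ} (R : L.Relations n) (ts : Fin n → L.Term ℕ)
  | nrel {n : ℕ} (R : L.Relations n) (ts : Fin n → L.Term ℕ)
  | eq (t u : L.Term ℕ)
  | neq (t u : L.Term ℕ)
  | incl {k : ℕ} (ts us : Fin k → L.Term ℕ)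
  | and (φ ψ : IncForm L)
  | or (φ ψ : IncForm L)
  | ex (v : ℕ) (φ : IncForm L)
  | all (v : ℕ) (φ : IncForm L)

variable {L : Language}

/-- The supplemented team `X[H/v]`. -/
def suppTeam {M : Type*} (X : Set (ℕ → M)) (H : (ℕ → M) → Set M) (v : ℕ) : Set (ℕ → M) :=
  {t | ∃ s ∈ X, ∃ m ∈ H s, t = Function.update s v m}

/-- The duplicated team `X[M/v]`. -/
def dupTeam (M : Type*) (X : Set (ℕ → M)) (v : ℕ) : Set (ℕ → M) :=
  {t | ∃ s ∈ X, ∃ m : M, t = Function.update s v m}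

/-- Lax team semantics for Inclusion Logic: `teamSat M φ X` says `M ⊨_X φ`. -/
def teamSat (M : Type*) [L.Structure M] : IncForm L → Set (ℕ → M) → Prop
  | .rel R ts, X => ∀ s ∈ X, Structure.RelMap R fun i => (ts i).realize s
  | .nrel R ts, X => ∀ s ∈ X, ¬ Structure.RelMap R fun i => (ts i).realize s
  | .eq t u, X => ∀ s ∈ X, t.realize s = u.realize s
  | .neq t u, X => ∀ s ∈ X, t.realize s ≠ u.realize s
  | .incl ts us, X => ∀ s ∈ X, ∃ s' ∈ X, ∀ i, (ts i).realize s = (us i).realize s'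
  | .and φ ψ, X => teamSat M φ X ∧ teamSat M ψ X
  | .or φ ψ, X => ∃ Y Z, X = Y ∪ Z ∧ teamSat M φ Y ∧ teamSat M ψ Z
  | .ex v φ, X => ∃ H : (ℕ → M) → Set M, (∀ s ∈ X, (H s).Nonempty) ∧
      teamSat M φ (suppTeam X H v)
  | .all v φ, X => teamSat M φ (dupTeam M X v)

/-- Free variables of an Inclusion Logic formula. -/
def fvInc : IncForm L → Set ℕ
  | .rel _ ts => ⋃ i, tvars (ts i)
  | .nrel _ ts => ⋃ i, tvars (ts i)
  | .eq t u => tvars t ∪ tvars u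
  | .neq t u => tvars t ∪ tvars u
  | .incl ts us => (⋃ i, tvars (ts i)) ∪ ⋃ i, tvars (us i)
  | .and φ ψ => fvInc φ ∪ fvInc ψ
  | .or φ ψ => fvInc φ ∪ fvInc ψ
  | .ex v φ => fvInc φ \ {v}
  | .all v φ => fvInc φ \ {v}

/-- Truth of an FO(⊆) sentence in a model: satisfaction by the team consisting of the
empty assignment (encoded, with total assignments, as the singleton team `{s}` for
every `s`; for sentences all these coincide). -/
def incTrue (M : Type*) [L.Structure M] (φ : IncForm L) : Prop :=
  ∀ s : ℕ → M, teamSat M φ {s}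

/-- The relation `X(x̄)` of values of a team, for `x̄ = (x_0, …, x_{n-1})` where we use
the variables `0, …, n-1` for `x₁, …, xₙ`. -/
def teamRel (n : ℕ) {M : Type*} (X : Set (ℕ → M)) : Set (Fin n → M) :=
  {a | ∃ s ∈ X, a = fun j : Fin n => s (j : ℕ)}

end TeamSem
namespace TeamSem

/-- The signature consisting of a single `n`-ary relation symbol `R`. -/
def LR (n : ℕ) : Language := ⟨fun _ => Empty, fun k => PLift (k = n)⟩

/-- The `n`-ary relation symbol `R` of `LR n`. -/
def Rsym (n : ℕ) : (LR n).Relations n := PLift.up rfl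

/-- The `LR n`-structure on `M` interpreting `R` as the relation `P`. -/
def withRel {M : Type*} (n : ℕ) (P : Set (Fin n → M)) : (LR n).Structure M where
  funMap := fun f _ => f.elim
  RelMap := fun {_} r x => (fun j : Fin n => x (Fin.cast r.down.symm j)) ∈ P

/-- `satR L n M P φ` says that the expansion `(M, P)` of the `L`-structure `M`,
interpreting the extra `n`-ary relation symbol `R` as `P`, satisfies the
first-order sentence `φ` over the signature `Σ ∪ {R}`. -/
def satR (L : Language) (n : ℕ) (M : Type*) [L.Structure M] (P : Set (Fin n → M))
    (φ : (L.sum (LR n)).Sentence) : Prop :=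
  letI : (LR n).Structure M := withRel n P
  φ.Realize M

/-- `OnlyPos n φ b` says that in the first-order formula `φ` over `Σ ∪ {R}`, every
occurrence of the extra relation symbol `R` has polarity `b` (`b = true`: positive). -/
def OnlyPos {L : Language} (n : ℕ) :
    ∀ {α : Type} {k : ℕ}, (L.sum (LR n)).BoundedFormula α k → Bool → Prop
  | _, _, .falsum, _ => True
  | _, _, .equal _ _, _ => True
  | _, _, .rel R _, b =>
      match R with
      | Sum.inl _ => True
      | Sum.inr _ => b = true
  | _, _, .imp f g, b => OnlyPos n f (!b) ∧ OnlyPos n g b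
  | _, _, .all f, b => OnlyPos n f b

/-- The myopic sentence `∀x̄ (Rx̄ → θ(R, x̄))`. -/
def myopic {L : Language} (n : ℕ) (θ : (L.sum (LR n)).BoundedFormula Empty n) :
    (L.sum (LR n)).Sentence :=
  (BoundedFormula.imp
    (BoundedFormula.rel (Sum.inr (Rsym n)) (fun j => Term.var (Sum.inr j))) θ).alls

end TeamSem

namespace TeamSem

open FirstOrder.Language Filter

section Positivity

variable {L : Language} {n k : ℕ} {α : Type} {f g : (L.sum (LR n)).BoundedFormula α k} {b : Bool}

theorem onlyPos_imp : OnlyPos n (f.imp g) b ↔ OnlyPos n f (!b) ∧ OnlyPos n g b := by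
  rw [OnlyPos]

theorem onlyPos_falsum :
    OnlyPos n (BoundedFormula.falsum : (L.sum (LR n)).BoundedFormula α k) b := by
  rw [OnlyPos]; trivial

theorem onlyPos_not (h : OnlyPos n f (!b)) : OnlyPos n f.not b :=
  onlyPos_imp.2 ⟨h, onlyPos_falsum⟩

theorem onlyPos_top : OnlyPos n (⊤ : (L.sum (LR n)).BoundedFormula α k) b :=
  onlyPos_not onlyPos_falsum

theorem onlyPos_inf (hf : OnlyPos n f b) (hg : OnlyPos n g b) : OnlyPos n (f ⊓ g) b :=
  onlyPos_not (onlyPos_imp.2 ⟨by simpa, onlyPos_not (by simpa)⟩)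

theorem onlyPos_sup (hf : OnlyPos n f b) (hg : OnlyPos n g b) : OnlyPos n (f ⊔ g) b :=
  onlyPos_imp.2 ⟨onlyPos_not (by simpa), hg⟩

theorem onlyPos_all {f : (L.sum (LR n)).BoundedFormula α (k + 1)} :
    OnlyPos n f.all b ↔ OnlyPos n f b := by
  rw [OnlyPos]

theorem onlyPos_ex {f : (L.sum (LR n)).BoundedFormula α (k + 1)} (hf : OnlyPos n f b) :
    OnlyPos n f.ex b :=
  onlyPos_not (onlyPos_all.2 (onlyPos_not (by simpa)))

theorem onlyPos_foldr_inf (l : List ((L.sum (LR n)).BoundedFormula α k))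
    (h : ∀ f ∈ l, OnlyPos n f b) : OnlyPos n (l.foldr (· ⊓ ·) ⊤) b := by
  induction l with
  | nil => exact onlyPos_top
  | cons a l ih =>
    exact onlyPos_inf (h a (by simp)) (ih fun f hf => h f (by simp [hf]))

theorem onlyPos_foldr_sup (l : List ((L.sum (LR n)).BoundedFormula α k))
    (h : ∀ f ∈ l, OnlyPos n f b) : OnlyPos n (l.foldr (· ⊔ ·) ⊥) b := by
  induction l with
  | nil => exact onlyPos_falsum
  | cons a l ih =>
    exact onlyPos_sup (h a (by simp)) (ih fun f hf => h f (by simp [hf]))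

end Positivity

section Saturation

/-- Countable sets of formulas in one variable, with finitely many parameters,
that are finitely satisfiable in `M` are satisfiable in `M`. -/
def CountablySaturated (K : Language) (M : Type) [K.Structure M] : Prop :=
  ∀ (m k : ℕ) (v : Fin m → M) (xs : Fin k → M) (g : ℕ → K.BoundedFormula (Fin m) (k + 1)),
    (∀ N, ∃ y, ∀ i < N, (g i).Realize v (Fin.snoc xs y)) →
      ∃ y, ∀ i, (g i).Realize v (Fin.snoc xs y)

theorem countablySaturated_product {K : Language} (M : ℕ → Type) [∀ j, Nonempty (M j)]
    [∀ j, K.Structure (M j)] :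
    CountablySaturated K (((hyperfilter ℕ : Ultrafilter ℕ) : Filter ℕ).Product M) := by
  classical
  intro m k v xs g hfin
  choose v' hv' using fun i => Quotient.exists_rep (v i)
  choose xs' hxs' using fun i => Quotient.exists_rep (xs i)
  obtain rfl : (fun i => Quotient.mk _ (v' i)) = v := funext hv'
  obtain rfl : (fun i => Quotient.mk _ (xs' i)) = xs := funext hxs'
  have snoc_rep : ∀ (y : ∀ j, M j),
      (Fin.snoc (fun i => Quotient.mk _ (xs' i)) (Quotient.mk _ y) :
        Fin (k + 1) → ((hyperfilter ℕ : Ultrafilter ℕ) : Filter ℕ).Product M) =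
      fun i => Quotient.mk _ ((Fin.snoc xs' y : Fin (k + 1) → ∀ j, M j) i) := by
    intro y
    funext i
    refine Fin.lastCases ?_ (fun i => ?_) i
    · rw [Fin.snoc_last (α := fun _ => ∀ j, M j)]
      exact Fin.snoc_last (α := fun _ => Quotient _) _ _
    · rw [Fin.snoc_castSucc (α := fun _ => ∀ j, M j)]
      exact Fin.snoc_castSucc (α := fun _ => Quotient _) _ _ _
  have snoc_app : ∀ (y : ∀ j, M j) (j : ℕ),
      (fun i => (Fin.snoc xs' y : Fin (k + 1) → ∀ j, M j) i j) =
        Fin.snoc (fun i => xs' i j) (y j) := by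
    intro y j
    funext i
    refine Fin.lastCases ?_ (fun i => ?_) i <;> simp
  have los : ∀ (f : K.BoundedFormula (Fin m) (k + 1)) (y : ∀ j, M j),
      f.Realize (fun i => Quotient.mk _ (v' i))
        (Fin.snoc (fun i => Quotient.mk _ (xs' i)) (Quotient.mk _ y) :
          Fin (k + 1) → ((hyperfilter ℕ : Ultrafilter ℕ) : Filter ℕ).Product M) ↔
      ∀ᶠ j in (hyperfilter ℕ : Ultrafilter ℕ),
        f.Realize (fun i => v' i j) (Fin.snoc (fun i => xs' i j) (y j)) := by
    intro f y
    rw [snoc_rep]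
    refine (Ultraproduct.boundedFormula_realize_cast f v' (Fin.snoc xs' y)).trans ?_
    simp only [snoc_app]
  have hN : ∀ N, ∀ᶠ j in (hyperfilter ℕ : Ultrafilter ℕ), N ≤ j ∧ ∃ y,
      ∀ i < N, (g i).Realize (fun i => v' i j) (Fin.snoc (fun i => xs' i j) y) := by
    intro N
    obtain ⟨y, hy⟩ := hfin N
    obtain ⟨y, rfl⟩ := Quotient.exists_rep y
    have h1 : ∀ᶠ j in (hyperfilter ℕ : Ultrafilter ℕ), N ≤ j :=
      (Nat.hyperfilter_le_atTop) (eventually_ge_atTop N)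
    have h2 : ∀ᶠ j in (hyperfilter ℕ : Ultrafilter ℕ), ∀ i ∈ Finset.range N,
        (g i).Realize (fun i => v' i j) (Fin.snoc (fun i => xs' i j) (y j)) :=
      (eventually_all_finset _).2 fun i hi => (los _ _).1 (hy i (Finset.mem_range.1 hi))
    filter_upwards [h1, h2] with j hj hj'
    exact ⟨hj, y j, fun i hi => hj' i (Finset.mem_range.2 hi)⟩
  let Q : ℕ → ℕ → Prop := fun j N => ∃ y,
    ∀ i < N, (g i).Realize (fun i => v' i j) (Fin.snoc (fun i => xs' i j) y)
  have hQ0 : ∀ j, Q j 0 := fun j => ⟨Classical.arbitrary _, by simp⟩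
  have hQ : ∀ j, Q j (Nat.findGreatest (Q j) j) := fun j =>
    Nat.findGreatest_spec (Nat.zero_le j) (hQ0 j)
  choose y hy using hQ
  refine ⟨Quotient.mk _ y, fun i => (los _ _).2 ?_⟩
  filter_upwards [hN (i + 1)] with j hj
  exact hy j i (Nat.lt_of_succ_le (Nat.le_findGreatest hj.1 hj.2))

end Saturation

section GenericSequence

/-- A sequence meeting countably many extension requirements, each of them cofinally often. -/
theorem exists_generic_seq {D ι : Type*} [Nonempty D] [Countable ι] [Nonempty ι]
    (Good : ℕ → (ℕ → D) → Prop) (Ext : ι → ℕ → (ℕ → D) → Prop)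
    (good_congr : ∀ k e e', (∀ j < k, e j = e' j) → Good k e → Good k e')
    (ext_congr : ∀ i k e e', (∀ j ≤ k, e j = e' j) → Ext i k e → Ext i k e')
    (good_zero : ∀ e, Good 0 e)
    (step : ∀ i k e, Good k e →
      ∃ d, Good (k + 1) (Function.update e k d) ∧ Ext i k (Function.update e k d)) :
    ∃ e : ℕ → D, (∀ k, Good k e) ∧ ∀ i N, ∃ k ≥ N, Ext i k e := by
  obtain ⟨task, htask⟩ := exists_surjective_nat (ι × ℕ)
  choose! d hd using step
  let E : ∀ k, {e : ℕ → D // Good k e} := fun k =>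
    Nat.rec ⟨fun _ => Classical.arbitrary D, good_zero _⟩
      (fun k e => ⟨Function.update e.1 k (d (task k).1 k e.1), (hd _ _ _ e.2).1⟩) k
  have hE : ∀ k, (E (k + 1)).1 = Function.update (E k).1 k (d (task k).1 k (E k).1) :=
    fun k => rfl
  have agree : ∀ k, ∀ j < k, (E k).1 j = (E (j + 1)).1 j := by
    intro k
    induction k with
    | zero => intro j hj; omega
    | succ k ih =>
      intro j hj
      rcases Nat.lt_succ_iff_lt_or_eq.1 hj with h | rfl
      · rw [hE, Function.update_of_ne h.ne, ih j h]
      · rfl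
  refine ⟨fun j => (E (j + 1)).1 j, fun k => good_congr k _ _ (agree k) (E k).2, fun i N => ?_⟩
  have hinf : {k | (task k).1 = i}.Infinite := by
    choose f hf using fun m => htask (i, m)
    refine Set.infinite_of_injective_forall_mem (f := f) (fun m m' h => ?_) fun m => ?_
    · have := hf m
      rw [h, hf m'] at this
      exact (Prod.mk.inj this).2.symm
    · simp [hf m]
  obtain ⟨k, hk, hNk⟩ := hinf.exists_gt N
  refine ⟨k, hNk.le, ext_congr i k (E (k + 1)).1 _ (fun j hj => agree _ j (by omega)) ?_⟩
  have := (hd (task k).1 k (E k).1 (E k).2).2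
  rw [← hE] at this
  exact (show (task k).1 = i from hk) ▸ this

end GenericSequence

section BackAndForth

variable {L : Language} {n k : ℕ} {M N : Type} [(L.sum (LR n)).Structure M]
  [(L.sum (LR n)).Structure N]

/-- Every `R`-positive formula true of the tuples `d, b` is true of the tuples `c, a`. -/
def PosTransfer (d : Fin n → N) (b : Fin k → N) (c : Fin n → M) (a : Fin k → M) : Prop :=
  ∀ f : (L.sum (LR n)).BoundedFormula (Fin n) k, OnlyPos n f true → f.Realize d b → f.Realize c a

instance countable_boundedFormula {K : Language} {α : Type*} [Countable α] [Countable K.Symbols]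
    (k : ℕ) : Countable (K.BoundedFormula α k) :=
  Function.Injective.countable
    (f := fun φ => (⟨k, φ⟩ : Σ n, K.BoundedFormula α n)) sigma_mk_injective

variable {d : Fin n → N} {b : Fin k → N} {c : Fin n → M} {a : Fin k → M}

theorem PosTransfer.forth [Countable (L.sum (LR n)).Symbols]
    (hN : CountablySaturated (L.sum (LR n)) N) (h : PosTransfer (L := L) d b c a) (a' : M) :
    ∃ b', PosTransfer (L := L) d (Fin.snoc b b' : Fin (k + 1) → N) c
      (Fin.snoc a a' : Fin (k + 1) → M) := by
  let F : Set ((L.sum (LR n)).BoundedFormula (Fin n) (k + 1)) :=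
    {f | OnlyPos n f true ∧ ¬ f.Realize c (Fin.snoc a a')}
  obtain ⟨g, hg⟩ := (Set.to_countable F).exists_eq_range ⟨⊥, onlyPos_falsum, id⟩
  have hgF : ∀ i, g i ∈ F := fun i => hg ▸ Set.mem_range_self i
  obtain ⟨b', hb'⟩ := hN n k d b (fun i => (g i).not) (by
    intro m
    by_contra! hcon
    have := h (((List.range m).map g).foldr (· ⊔ ·) ⊥).all
      (onlyPos_all.2 (onlyPos_foldr_sup _ (by
        intro f hf
        obtain ⟨i, -, rfl⟩ := List.mem_map.1 hf
        exact (hgF i).1))) (by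
        intro y
        obtain ⟨i, hi, hy⟩ := hcon y
        rw [BoundedFormula.realize_foldr_sup]
        exact ⟨g i, List.mem_map.2 ⟨i, List.mem_range.2 hi, rfl⟩, by simpa using hy⟩)
    obtain ⟨f, hf, hfa⟩ := (BoundedFormula.realize_foldr_sup _ _ _).1 (this a')
    obtain ⟨i, -, rfl⟩ := List.mem_map.1 hf
    exact (hgF i).2 hfa)
  refine ⟨b', fun f hf hfb => ?_⟩
  by_contra hfa
  obtain ⟨i, rfl⟩ : f ∈ Set.range g := hg ▸ (⟨hf, hfa⟩ : f ∈ F)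
  exact BoundedFormula.realize_not.1 (hb' i) hfb

theorem PosTransfer.back [Countable (L.sum (LR n)).Symbols]
    (hM : CountablySaturated (L.sum (LR n)) M) (h : PosTransfer (L := L) d b c a) (b' : N) :
    ∃ a', PosTransfer (L := L) d (Fin.snoc b b' : Fin (k + 1) → N) c
      (Fin.snoc a a' : Fin (k + 1) → M) := by
  let F : Set ((L.sum (LR n)).BoundedFormula (Fin n) (k + 1)) :=
    {f | OnlyPos n f true ∧ f.Realize d (Fin.snoc b b')}
  obtain ⟨g, hg⟩ := (Set.to_countable F).exists_eq_range
    ⟨⊤, onlyPos_top, BoundedFormula.realize_top.2 trivial⟩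
  have hgF : ∀ i, g i ∈ F := fun i => hg ▸ Set.mem_range_self i
  obtain ⟨a', ha'⟩ := hM n k c a g (by
    intro m
    have := h (((List.range m).map g).foldr (· ⊓ ·) ⊤).ex
      (onlyPos_ex (onlyPos_foldr_inf _ (by
        intro f hf
        obtain ⟨i, -, rfl⟩ := List.mem_map.1 hf
        exact (hgF i).1))) (by
        rw [BoundedFormula.realize_ex]
        refine ⟨b', ?_⟩
        rw [BoundedFormula.realize_foldr_inf]
        intro f hf
        obtain ⟨i, -, rfl⟩ := List.mem_map.1 hf
        exact (hgF i).2)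
    obtain ⟨y, hy⟩ := BoundedFormula.realize_ex.1 this
    rw [BoundedFormula.realize_foldr_inf] at hy
    exact ⟨y, fun i hi => hy _ (List.mem_map.2 ⟨i, List.mem_range.2 hi, rfl⟩)⟩)
  refine ⟨a', fun f hf hfb => ?_⟩
  obtain ⟨i, rfl⟩ : f ∈ Set.range g := hg ▸ (⟨hf, hfb⟩ : f ∈ F)
  exact ha' i

end BackAndForth

section Indexing

theorem sentence_realize_iff_of_indexing {K : Language} {W N : Type} [K.Structure W]
    [K.Structure N] (a : ℕ → W) (b : ℕ → N) (ha : Function.Surjective a)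
    (heq : ∀ i j, a i = a j ↔ b i = b j)
    (hfun : ∀ m (f : K.Functions m) (x : Fin m → ℕ) y,
      Structure.funMap f (a ∘ x) = a y → Structure.funMap f (b ∘ x) = b y)
    (hrel : ∀ m (r : K.Relations m) (x : Fin m → ℕ),
      Structure.RelMap r (a ∘ x) ↔ Structure.RelMap r (b ∘ x))
    (htv : ∀ m (f : K.BoundedFormula Empty (m + 1)) (x : Fin m → ℕ),
      (∃ z, f.Realize default (Fin.snoc (b ∘ x) z : Fin (m + 1) → N)) →
        ∃ j, f.Realize default (Fin.snoc (b ∘ x) (b j) : Fin (m + 1) → N))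
    (φ : K.Sentence) : W ⊨ φ ↔ N ⊨ φ := by
  let g := Function.surjInv ha
  have hg : ∀ w, a (g w) = w := Function.surjInv_eq ha
  have hag : ∀ {m} (x : Fin m → W), x = a ∘ (g ∘ x) := fun x => funext fun i => (hg _).symm
  let h : W ↪[K] N :=
    { toFun := b ∘ g
      inj' := fun w w' hw => by
        have := (heq (g w) (g w')).2 hw
        rwa [hg, hg] at this
      map_fun' := fun f x => by
        refine (hfun _ f (g ∘ x) _ ?_).symm
        rw [hg, ← hag]
      map_rel' := fun r x => by
        conv_rhs => rw [hag x]
        exact (hrel _ r (g ∘ x)).symm }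
  let e : W ↪ₑ[K] N := ⟨h, fun _ φ => h.isElementary_of_exists (by
    intro m f x z hz
    obtain ⟨j, hj⟩ := htv m f (g ∘ x) ⟨z, hz⟩
    refine ⟨a j, ?_⟩
    have : h (a j) = b j := (heq _ _).1 (hg (a j))
    rw [this]
    exact hj) φ⟩
  exact e.map_sentence φ

/-- The interpretation of the extra relation symbol. -/
def relOf (L : Language) (n : ℕ) (M : Type) [(L.sum (LR n)).Structure M] : Set (Fin n → M) :=
  {x | Structure.RelMap (L := L.sum (LR n)) (Sum.inr (Rsym n)) x}

theorem satR_iff_of_indexing {L : Language} {n : ℕ} {W N : Type} [L.Structure W]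
    [(L.sum (LR n)).Structure N] (S : Set (Fin n → W)) (a : ℕ → W) (b : ℕ → N)
    (ha : Function.Surjective a)
    (heq : ∀ i j, a i = a j ↔ b i = b j)
    (hfun : ∀ m (f : L.Functions m) (x : Fin m → ℕ) y, Structure.funMap f (a ∘ x) = a y →
      Structure.funMap (L := L.sum (LR n)) (Sum.inl f) (b ∘ x) = b y)
    (hrel : ∀ m (r : L.Relations m) (x : Fin m → ℕ), Structure.RelMap r (a ∘ x) ↔
      Structure.RelMap (L := L.sum (LR n)) (Sum.inl r) (b ∘ x))
    (hS : ∀ x : Fin n → ℕ, a ∘ x ∈ S ↔ b ∘ x ∈ relOf L n N)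
    (htv : ∀ m (f : (L.sum (LR n)).BoundedFormula Empty (m + 1)) (x : Fin m → ℕ),
      (∃ z, f.Realize default (Fin.snoc (b ∘ x) z : Fin (m + 1) → N)) →
        ∃ j, f.Realize default (Fin.snoc (b ∘ x) (b j) : Fin (m + 1) → N))
    (φ : (L.sum (LR n)).Sentence) : satR L n W S φ ↔ N ⊨ φ := by
  let _ : (LR n).Structure W := withRel n S
  refine sentence_realize_iff_of_indexing a b ha heq ?_ ?_ htv φ
  · rintro m (f | f) x y h
    · exact hfun m f x y h
    · exact f.elim
  · rintro m (r | r) x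
    · exact hrel m r x
    · obtain ⟨rfl⟩ := r
      exact hS x

end Indexing

section Preservation

theorem snoc_update {D B : Type*} (k : ℕ) (e : ℕ → D) (d : D) (π : D → B) :
    (fun i : Fin (k + 1) => π (Function.update e k d i)) =
      Fin.snoc (α := fun _ => B) (fun i : Fin k => π (e i)) (π d) := by
  funext i
  refine Fin.lastCases ?_ (fun i => ?_) i
  · simp
  · simp [Function.update_of_ne i.2.ne]

theorem exists_lt_of_fin {m : ℕ} (x : Fin m → ℕ) : ∃ k, ∀ i, x i < k :=
  ⟨Finset.univ.sup x + 1, fun i => Nat.lt_succ_of_le (Finset.le_sup (Finset.mem_univ i))⟩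

section Atomic

variable {L : Language} {n : ℕ} {M N : Type} [(L.sum (LR n)).Structure M]
  [(L.sum (LR n)).Structure N] {d : Fin n → N} {b : ℕ → N} {c : Fin n → M} {a : ℕ → M}

theorem PosTransfer.eq_iff
    (h : ∀ k, PosTransfer (L := L) d (fun i : Fin k => b i) c (fun i : Fin k => a i)) (i j : ℕ) :
    a i = a j ↔ b i = b j := by
  obtain ⟨k, hk⟩ := exists_lt_of_fin ![i, j]
  have hi : i < k := hk 0
  have hj : j < k := hk 1
  let f : (L.sum (LR n)).BoundedFormula (Fin n) k :=
    .equal (.var (.inr ⟨i, hi⟩)) (.var (.inr ⟨j, hj⟩))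
  have hf : ∀ p, OnlyPos n f p := fun p => by rw [OnlyPos]; trivial
  refine ⟨fun hab => ?_, fun hb => h k f (hf _) hb⟩
  by_contra hb
  exact h k f.not (onlyPos_not (hf _)) hb hab

theorem PosTransfer.free_eq
    (h : ∀ k, PosTransfer (L := L) d (fun i : Fin k => b i) c (fun i : Fin k => a i))
    {i : ℕ} {j : Fin n} (hab : c j = a i) : d j = b i := by
  let f : (L.sum (LR n)).BoundedFormula (Fin n) (i + 1) :=
    .equal (.var (.inl j)) (.var (.inr ⟨i, i.lt_succ_self⟩))
  have hf : ∀ p, OnlyPos n f p := fun p => by rw [OnlyPos]; trivial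
  by_contra hb
  exact h (i + 1) f.not (onlyPos_not (hf _)) hb hab

theorem PosTransfer.funMap_eq
    (h : ∀ k, PosTransfer (L := L) d (fun i : Fin k => b i) c (fun i : Fin k => a i))
    {m : ℕ} (F : (L.sum (LR n)).Functions m) (x : Fin m → ℕ) (y : ℕ)
    (hab : Structure.funMap F (a ∘ x) = a y) : Structure.funMap F (b ∘ x) = b y := by
  obtain ⟨k, hk⟩ := exists_lt_of_fin (Fin.snoc x y : Fin (m + 1) → ℕ)
  have hx : ∀ i, x i < k := fun i => by simpa using hk i.castSucc
  have hy : y < k := by simpa using hk (Fin.last m)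
  let f : (L.sum (LR n)).BoundedFormula (Fin n) k :=
    .equal (.func F fun i => .var (.inr ⟨x i, hx i⟩)) (.var (.inr ⟨y, hy⟩))
  have hf : ∀ p, OnlyPos n f p := fun p => by rw [OnlyPos]; trivial
  by_contra hb
  exact h k f.not (onlyPos_not (hf _)) hb hab

theorem PosTransfer.relMap_iff
    (h : ∀ k, PosTransfer (L := L) d (fun i : Fin k => b i) c (fun i : Fin k => a i))
    {m : ℕ} (r : L.Relations m) (x : Fin m → ℕ) :
    Structure.RelMap (L := L.sum (LR n)) (Sum.inl r) (a ∘ x) ↔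
      Structure.RelMap (L := L.sum (LR n)) (Sum.inl r) (b ∘ x) := by
  obtain ⟨k, hx⟩ := exists_lt_of_fin x
  let f : (L.sum (LR n)).BoundedFormula (Fin n) k :=
    .rel (Sum.inl r) fun i => .var (.inr ⟨x i, hx i⟩)
  have hf : ∀ p, OnlyPos n f p := fun p => by rw [OnlyPos]; trivial
  refine ⟨fun hab => ?_, fun hb => h k f (hf _) hb⟩
  by_contra hb
  exact h k f.not (onlyPos_not (hf _)) hb hab

theorem PosTransfer.mem_relOf
    (h : ∀ k, PosTransfer (L := L) d (fun i : Fin k => b i) c (fun i : Fin k => a i))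
    (x : Fin n → ℕ) (hb : b ∘ x ∈ relOf L n N) : a ∘ x ∈ relOf L n M := by
  obtain ⟨k, hx⟩ := exists_lt_of_fin x
  let f : (L.sum (LR n)).BoundedFormula (Fin n) k :=
    .rel (Sum.inr (Rsym n)) fun i => .var (.inr ⟨x i, hx i⟩)
  have hf : OnlyPos n f true := by rw [OnlyPos]
  exact h k f hf hb

end Atomic

/-- The extension requirement for the Tarski–Vaught test: either for the first coordinates, or
for the coordinates indexed by the tuple at the positions `t`. -/
def TVStep {K : Language} {n : ℕ} {M : Type} {C : Set (Fin n → M)} (N : C → Type)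
    [K.Structure M] [∀ c, K.Structure (N c)] :
    (Option (Fin n → ℕ) × Σ m, K.BoundedFormula Empty (m + 1) × (Fin m → ℕ)) → ℕ →
      (ℕ → M × ∀ c, N c) → Prop
  | (none, ⟨m, f, s⟩), k, e => (∀ i, s i < k) →
      (∃ z, f.Realize default (Fin.snoc (fun i => (e (s i)).1) z : Fin (m + 1) → M)) →
      f.Realize default (Fin.snoc (fun i => (e (s i)).1) (e k).1 : Fin (m + 1) → M)
  | (some t, ⟨m, f, s⟩), k, e => (∀ i, s i < k) → ∀ c : C,
      (∀ j, t j < k ∧ c.1 j = (e (t j)).1) →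
      (∃ z, f.Realize default (Fin.snoc (fun i => (e (s i)).2 c) z : Fin (m + 1) → N c)) →
      f.Realize default (Fin.snoc (fun i => (e (s i)).2 c) ((e k).2 c) : Fin (m + 1) → N c)

theorem tvStep_congr {K : Language} {n : ℕ} {M : Type} {C : Set (Fin n → M)} (N : C → Type)
    [K.Structure M] [∀ c, K.Structure (N c)]
    (i : Option (Fin n → ℕ) × Σ m, K.BoundedFormula Empty (m + 1) × (Fin m → ℕ)) (k : ℕ)
    (e e' : ℕ → M × ∀ c, N c) (hee : ∀ j ≤ k, e j = e' j) (h : TVStep N i k e) :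
    TVStep N i k e' := by
  obtain ⟨_ | t, m, f, s⟩ := i
  · intro hs
    have hs' : ∀ i, e' (s i) = e (s i) := fun i => (hee _ (hs i).le).symm
    simp only [hs', ← hee k le_rfl]
    exact h hs
  · intro hs c ht
    have hs' : ∀ i, e' (s i) = e (s i) := fun i => (hee _ (hs i).le).symm
    simp only [hs', ← hee k le_rfl]
    exact h hs c fun j => ⟨(ht j).1, by rw [(ht j).2, hee _ (ht j).1.le]⟩

variable {L : Language} {n : ℕ}

theorem exists_generic_family [Countable (L.sum (LR n)).Symbols] {M : Type} [Nonempty M]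
    [(L.sum (LR n)).Structure M] (hM : CountablySaturated (L.sum (LR n)) M)
    {C : Set (Fin n → M)} (N : C → Type) [∀ c, Nonempty (N c)]
    [∀ c, (L.sum (LR n)).Structure (N c)] (hN : ∀ c, CountablySaturated (L.sum (LR n)) (N c))
    (d : ∀ c, Fin n → N c)
    (hd : ∀ c (a : Fin 0 → M) (b : Fin 0 → N c), PosTransfer (L := L) (d c) b c.1 a) :
    ∃ e : ℕ → M × ∀ c, N c,
      (∀ k c, PosTransfer (L := L) (d c) (fun i : Fin k => (e i).2 c) c.1
        (fun i : Fin k => (e i).1)) ∧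
      ∀ i k₀, ∃ k ≥ k₀, TVStep (K := L.sum (LR n)) N i k e := by
  classical
  refine exists_generic_seq
    (fun k e => ∀ c, PosTransfer (L := L) (d c) (fun i : Fin k => (e i).2 c) c.1
        (fun i : Fin k => (e i).1)) (TVStep (K := L.sum (LR n)) N) ?_ (tvStep_congr N) ?_ ?_
  · intro k e e' hee h c
    have : ∀ i : Fin k, e' i = e i := fun i => (hee i i.2).symm
    simpa only [this] using h c
  · intro e c
    exact hd c _ _
  · intro i k e hgood
    have good_iff : ∀ p : M × ∀ c, N c,
        (∀ c, PosTransfer (L := L) (d c) (fun i : Fin (k + 1) => (Function.update e k p i).2 c) c.1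
          (fun i : Fin (k + 1) => (Function.update e k p i).1)) ↔
        ∀ c, PosTransfer (L := L) (d c)
          (Fin.snoc (fun i : Fin k => (e i).2 c) (p.2 c) : Fin (k + 1) → N c) c.1
          (Fin.snoc (fun i : Fin k => (e i).1) p.1 : Fin (k + 1) → M) := by
      intro p
      refine forall_congr' fun c => ?_
      rw [snoc_update k e p Prod.fst, snoc_update k e p (fun q => q.2 c)]
    have ext_lt : ∀ p : M × ∀ c, N c, ∀ j < k, Function.update e k p j = e j :=
      fun p j hj => Function.update_of_ne hj.ne _ _
    have forth : ∀ a' : M, ∃ p : M × ∀ c, N c, p.1 = a' ∧ ∀ c, PosTransfer (L := L) (d c)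
          (Fin.snoc (fun i : Fin k => (e i).2 c) (p.2 c) : Fin (k + 1) → N c) c.1
          (Fin.snoc (fun i : Fin k => (e i).1) p.1 : Fin (k + 1) → M) := by
      intro a'
      choose b' hb' using fun c => (hgood c).forth (hN c) a'
      exact ⟨(a', b'), rfl, hb'⟩
    have back : ∀ c₀ (b₀ : N c₀), ∃ p : M × ∀ c, N c, p.2 c₀ = b₀ ∧
        ∀ c, PosTransfer (L := L) (d c)
          (Fin.snoc (fun i : Fin k => (e i).2 c) (p.2 c) : Fin (k + 1) → N c) c.1
          (Fin.snoc (fun i : Fin k => (e i).1) p.1 : Fin (k + 1) → M) := by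
      intro c₀ b₀
      obtain ⟨a', ha'⟩ := (hgood c₀).back hM b₀
      obtain ⟨p, rfl, hp⟩ := forth a'
      refine ⟨(p.1, Function.update p.2 c₀ b₀), by simp, fun c => ?_⟩
      by_cases hc : c = c₀
      · subst hc
        simpa using ha'
      · simpa [Function.update_of_ne hc] using hp c
    obtain ⟨_ | t, m, f, s⟩ := i
    · by_cases hz : ∃ z, f.Realize default
          (Fin.snoc (fun i => (e (s i)).1) z : Fin (m + 1) → M)
      · obtain ⟨z, hz⟩ := hz
        obtain ⟨p, rfl, hp⟩ := forth z
        refine ⟨p, (good_iff p).2 hp, fun hs _ => ?_⟩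
        simpa [ext_lt p _ (hs _)] using hz
      · obtain ⟨p, -, hp⟩ := forth (Classical.arbitrary M)
        refine ⟨p, (good_iff p).2 hp, fun hs hz' => absurd ?_ hz⟩
        simpa only [ext_lt p _ (hs _)] using hz'
    · by_cases hc : ∃ c : C, (∀ j, c.1 j = (e (t j)).1) ∧ ∃ z, f.Realize default
          (Fin.snoc (fun i => (e (s i)).2 c) z : Fin (m + 1) → N c)
      · obtain ⟨c, hct, z, hz⟩ := hc
        obtain ⟨p, rfl, hp⟩ := back c z
        refine ⟨p, (good_iff p).2 hp, fun hs c' hct' _ => ?_⟩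
        obtain rfl : c' = c := Subtype.ext (funext fun j => by
          rw [hct, (hct' j).2, ext_lt p _ (hct' j).1])
        simpa [ext_lt p _ (hs _)] using hz
      · obtain ⟨p, -, hp⟩ := forth (Classical.arbitrary M)
        refine ⟨p, (good_iff p).2 hp, fun hs c hct hz' => absurd ⟨c, fun j => ?_, ?_⟩ hc⟩
        · rw [(hct j).2, ext_lt p _ (hct j).1]
        · simpa only [ext_lt p _ (hs _)] using hz'

theorem realize_of_forall_saturated_witness [Countable (L.sum (LR n)).Symbols]
    (φ : (L.sum (LR n)).Sentence)
    (hU : ∀ (M : Type) [Nonempty M] [L.Structure M]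
        (ι : Type) (P : ι → Set (Fin n → M)),
        (∀ i, satR L n M (P i) φ) → satR L n M (⋃ i, P i) φ)
    {M : Type} [Nonempty M]
    [(L.sum (LR n)).Structure M] (hM : CountablySaturated (L.sum (LR n)) M)
    (N : relOf L n M → Type) [∀ c, Nonempty (N c)]
    [∀ c, (L.sum (LR n)).Structure (N c)] (hN : ∀ c, CountablySaturated (L.sum (LR n)) (N c))
    (hφ : ∀ c, N c ⊨ φ)
    (d : ∀ c, Fin n → N c) (hdR : ∀ c, d c ∈ relOf L n (N c))
    (hd : ∀ c (a : Fin 0 → M) (b : Fin 0 → N c), PosTransfer (L := L) (d c) b c.1 a) :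
    M ⊨ φ := by
  obtain ⟨e, hgood, hTV⟩ := exists_generic_family hM N hN d hd
  have tvM : ∀ m (f : (L.sum (LR n)).BoundedFormula Empty (m + 1)) (x : Fin m → ℕ),
      (∃ z, f.Realize default (Fin.snoc (fun i => (e (x i)).1) z : Fin (m + 1) → M)) →
        ∃ j, f.Realize default (Fin.snoc (fun i => (e (x i)).1) (e j).1 : Fin (m + 1) → M) := by
    intro m f x hz
    obtain ⟨k₀, hk₀⟩ := exists_lt_of_fin x
    obtain ⟨k, hk, hstep⟩ := hTV (none, ⟨m, f, x⟩) k₀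
    exact ⟨k, hstep (fun i => (hk₀ i).trans_le hk) hz⟩
  have tvN : ∀ (c : relOf L n M) (t : Fin n → ℕ), (∀ j, c.1 j = (e (t j)).1) →
      ∀ m (f : (L.sum (LR n)).BoundedFormula Empty (m + 1)) (x : Fin m → ℕ),
      (∃ z, f.Realize default (Fin.snoc (fun i => (e (x i)).2 c) z : Fin (m + 1) → N c)) →
        ∃ j, f.Realize default
          (Fin.snoc (fun i => (e (x i)).2 c) ((e j).2 c) : Fin (m + 1) → N c) := by
    intro c t hct m f x hz
    obtain ⟨k₀, hk₀⟩ := exists_lt_of_fin x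
    obtain ⟨k₁, hk₁⟩ := exists_lt_of_fin t
    obtain ⟨k, hk, hstep⟩ := hTV (some t, ⟨m, f, x⟩) (max k₀ k₁)
    exact ⟨k, hstep (fun i => (hk₀ i).trans_le ((le_max_left _ _).trans hk)) c
      (fun j => ⟨(hk₁ j).trans_le ((le_max_right _ _).trans hk), hct j⟩) hz⟩
  have hclosed : ∀ m (f : L.Functions m) (x : Fin m → Set.range fun i => (e i).1),
      Structure.funMap (L := L.sum (LR n)) (Sum.inl f) (fun i => (x i).1) ∈
        Set.range fun i => (e i).1 := by
    intro m f x
    choose s hs using fun i => (x i).2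
    obtain ⟨j, hj⟩ := tvM m
      (.equal (.func (Sum.inl f) fun i => .var (.inr i.castSucc)) (.var (.inr (Fin.last m)))) s
      ⟨Structure.funMap (L := L.sum (LR n)) (Sum.inl f) (fun i => (e (s i)).1), by
        simp [BoundedFormula.Realize, Term.realize]⟩
    refine ⟨j, ?_⟩
    simp only [BoundedFormula.Realize, Term.realize, Sum.elim_inr, Fin.snoc_castSucc,
      Fin.snoc_last] at hj
    simp only at hs
    simp only [← hs, hj]
  let W : Type := Set.range fun i => (e i).1
  have : Nonempty W := ⟨⟨_, 0, rfl⟩⟩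
  let _ : L.Structure W :=
    { funMap := fun f x => ⟨_, hclosed _ f x⟩
      RelMap := fun r x => Structure.RelMap (L := L.sum (LR n)) (Sum.inl r) fun i => (x i).1 }
  let a : ℕ → W := fun i => ⟨(e i).1, i, rfl⟩
  have ha : Function.Surjective a := by
    rintro ⟨_, i, rfl⟩
    exact ⟨i, rfl⟩
  have hlift : ∀ x : Fin n → W, ∃ s : Fin n → ℕ, x = a ∘ s := by
    intro x
    choose s hs using fun i => ha (x i)
    exact ⟨s, funext fun i => (hs i).symm⟩
  have haeq : ∀ i j, a i = a j ↔ (e i).1 = (e j).1 := fun i j => Subtype.ext_iff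
  rw [← satR_iff_of_indexing (L := L) (W := W) {x | (fun i => (x i).1) ∈ relOf L n M} a
    (fun i => (e i).1) ha haeq (fun m f x y h => Subtype.ext_iff.1 h) (fun m r x => Iff.rfl)
    (fun x => Iff.rfl) tvM φ]
  let I : Type := {c : relOf L n M // ∃ t : Fin n → ℕ, ∀ j, c.1 j = (e (t j)).1}
  let S : I → Set (Fin n → W) := fun c =>
    {x | ∃ s : Fin n → ℕ, x = a ∘ s ∧ (fun i => (e (s i)).2 c.1) ∈ relOf L n (N c.1)}
  have hSU : {x : Fin n → W | (fun i => (x i).1) ∈ relOf L n M} = ⋃ c, S c := by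
    ext x
    simp only [Set.mem_iUnion]
    constructor
    · intro hx
      obtain ⟨t, rfl⟩ := hlift x
      let c : relOf L n M := ⟨_, hx⟩
      have hdc : (fun i => (e (t i)).2 c) = d c := funext fun j =>
        (PosTransfer.free_eq (L := L) (b := fun i => (e i).2 c) (a := fun i => (e i).1)
          (fun k => hgood k c) rfl).symm
      refine ⟨⟨c, t, fun j => rfl⟩, t, rfl, ?_⟩
      change (fun i => (e (t i)).2 c) ∈ relOf L n (N c)
      rw [hdc]
      exact hdR c
    · rintro ⟨c, s, rfl, hs⟩
      exact PosTransfer.mem_relOf (L := L) (b := fun i => (e i).2 c.1) (a := fun i => (e i).1)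
        (fun k => hgood k _) s hs
  rw [hSU]
  refine hU W I S fun ⟨c, t, ht⟩ => ?_
  have hab : ∀ i j, a i = a j ↔ (e i).2 c = (e j).2 c := fun i j =>
    (haeq i j).trans (PosTransfer.eq_iff (L := L) (b := fun i => (e i).2 c)
      (a := fun i => (e i).1) (fun k => hgood k c) i j)
  refine (satR_iff_of_indexing (L := L) (W := W) (N := N c) _ a (fun i => (e i).2 c) ha hab
    ?_ ?_ ?_ (tvN c t ht) φ).2 (hφ c)
  · intro m f x y h
    exact PosTransfer.funMap_eq (L := L) (b := fun i => (e i).2 c)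
      (a := fun i => (e i).1) (fun k => hgood k c) (Sum.inl f) x y (Subtype.ext_iff.1 h)
  · intro m r x
    exact PosTransfer.relMap_iff (L := L) (b := fun i => (e i).2 c)
      (a := fun i => (e i).1) (fun k => hgood k c) r x
  · intro x
    constructor
    · rintro ⟨s, hs, hsR⟩
      convert hsR using 1
      funext i
      exact (hab _ _).1 (congrFun hs i)
    · intro hx
      exact ⟨x, rfl, hx⟩

end Preservation

section Compactness

variable {L : Language} {n : ℕ}

/-- The atomic formula `R x̄`. -/
def relFormula (L : Language) (n : ℕ) : (L.sum (LR n)).Formula (Fin n) :=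
  .rel (Sum.inr (Rsym n)) fun j => .var (.inl j)

/-- Positive formulas that hold of all elements of `R` in all models of `φ`. -/
def posConsequences (φ : (L.sum (LR n)).Sentence) : Set ((L.sum (LR n)).Formula (Fin n)) :=
  {θ | OnlyPos n θ true ∧ ∀ (M : Type) [Nonempty M] [(L.sum (LR n)).Structure M],
    M ⊨ φ → ∀ c ∈ relOf L n M, θ.Realize c}

theorem realize_formula_hyperfilter {K : Language} {α : Type} (M : ℕ → Type)
    [∀ j, Nonempty (M j)] [∀ j, K.Structure (M j)] (f : K.Formula α) (v : α → ∀ j, M j) :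
    f.Realize (fun i => (Quotient.mk _ (v i) :
      ((hyperfilter ℕ : Ultrafilter ℕ) : Filter ℕ).Product M)) ↔
      ∀ᶠ j in (hyperfilter ℕ : Ultrafilter ℕ), f.Realize fun i => v i j :=
  Ultraproduct.realize_formula_cast f v

theorem eventually_hyperfilter_of_forall_lt {p : ℕ → Prop} (i : ℕ) (h : ∀ k, i < k → p k) :
    ∀ᶠ k in (hyperfilter ℕ : Ultrafilter ℕ), p k :=
  Nat.hyperfilter_le_atTop ((eventually_gt_atTop i).mono h)

theorem exists_saturated_witness [Countable (L.sum (LR n)).Symbols]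
    {φ : (L.sum (LR n)).Sentence} {M : Type} [(L.sum (LR n)).Structure M] {c : Fin n → M}
    (hc : ∀ θ ∈ posConsequences φ, θ.Realize c) :
    ∃ (N : Type) (_ : Nonempty N) (_ : (L.sum (LR n)).Structure N),
      CountablySaturated (L.sum (LR n)) N ∧ N ⊨ φ ∧ ∃ d ∈ relOf L n N,
        ∀ (a : Fin 0 → M) (b : Fin 0 → N), PosTransfer (L := L) d b c a := by
  obtain ⟨f, hf⟩ := (Set.to_countable
    {f : (L.sum (LR n)).Formula (Fin n) | OnlyPos n f true ∧ ¬ f.Realize c}).exists_eq_range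
    ⟨⊥, onlyPos_falsum, id⟩
  have hfi : ∀ i, OnlyPos n (f i) true ∧ ¬ (f i).Realize c := fun i =>
    (Set.ext_iff.1 hf (f i)).2 ⟨i, rfl⟩
  have key : ∀ k, ∃ (N : Type) (_ : Nonempty N) (_ : (L.sum (LR n)).Structure N),
      N ⊨ φ ∧ ∃ d ∈ relOf L n N, ∀ i < k, ¬ (f i).Realize d := by
    intro k
    let l := (List.range k).map f
    by_contra! hcon
    have hmem : (l.foldr (· ⊔ ·) ⊥ : (L.sum (LR n)).Formula (Fin n)) ∈ posConsequences φ := by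
      refine ⟨onlyPos_foldr_sup _ fun g hg => ?_, fun N _ _ hN d hd => ?_⟩
      · obtain ⟨i, -, rfl⟩ := List.mem_map.1 hg
        exact (hfi i).1
      · obtain ⟨i, hi, h⟩ := hcon N inferInstance inferInstance hN d hd
        exact (BoundedFormula.realize_foldr_sup _ _ _).2
          ⟨f i, List.mem_map.2 ⟨i, List.mem_range.2 hi, rfl⟩, h⟩
    obtain ⟨g, hg, h⟩ := (BoundedFormula.realize_foldr_sup _ _ _).1 (hc _ hmem)
    obtain ⟨i, -, rfl⟩ := List.mem_map.1 hg
    exact (hfi i).2 h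
  choose N hne hstr hφ d hdR hd using key
  refine ⟨((hyperfilter ℕ : Ultrafilter ℕ) : Filter ℕ).Product N, inferInstance, inferInstance,
    countablySaturated_product N,
    (Ultraproduct.sentence_realize φ).2 (Eventually.of_forall hφ),
    fun i => Quotient.mk _ fun j => d j i, ?_, ?_⟩
  · exact (realize_formula_hyperfilter N (relFormula L n) fun i j => d j i).2
      (Eventually.of_forall hdR)
  · intro a b g hg hgr
    obtain rfl := Subsingleton.elim a default
    obtain rfl := Subsingleton.elim b default
    by_contra hcon
    obtain ⟨i, rfl⟩ : g ∈ Set.range f := hf ▸ ⟨hg, hcon⟩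
    have h1 := (realize_formula_hyperfilter N (f i) fun i j => d j i).1 hgr
    have h2 := eventually_hyperfilter_of_forall_lt i fun k hk => hd k i hk
    obtain ⟨j, h1, h2⟩ := (h1.and h2).exists
    exact h2 h1

/-- Over a countable signature, a union-closed first-order property of `R` is axiomatised by
`∀ x̄ (R x̄ → θ)` for some formula `θ` in which `R` occurs only positively. -/
theorem exists_onlyPos_iff [Countable (L.sum (LR n)).Symbols]
    (φ : (L.sum (LR n)).Sentence)
    (hU : ∀ (M : Type) [Nonempty M] [L.Structure M]
        (ι : Type) (P : ι → Set (Fin n → M)),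
        (∀ i, satR L n M (P i) φ) → satR L n M (⋃ i, P i) φ) :
    ∃ θ : (L.sum (LR n)).Formula (Fin n), OnlyPos n θ true ∧
      ∀ (M : Type) [Nonempty M] [(L.sum (LR n)).Structure M],
        M ⊨ φ ↔ ∀ c ∈ relOf L n M, θ.Realize c := by
  obtain ⟨θ, hθ⟩ := (Set.to_countable (posConsequences φ)).exists_eq_range
    ⟨⊤, onlyPos_top, fun _ _ _ _ _ _ => BoundedFormula.realize_top.2 trivial⟩
  have hθi : ∀ i, θ i ∈ posConsequences φ := fun i => hθ.symm ▸ Set.mem_range_self (f := θ) i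
  let Θ : ℕ → (L.sum (LR n)).Formula (Fin n) := fun k =>
    ((List.range k).map θ).foldr (· ⊓ ·) ⊤
  have realize_Θ : ∀ k (M : Type) [(L.sum (LR n)).Structure M] (c : Fin n → M),
      (Θ k).Realize c ↔ ∀ i < k, (θ i).Realize c := by
    intro k M _ c
    refine (BoundedFormula.realize_foldr_inf _ _ _).trans ?_
    simp only [List.mem_map, List.mem_range, forall_exists_index, and_imp,
      forall_apply_eq_imp_iff₂]
    rfl
  by_contra! hcon
  have key : ∀ k, ∃ (M : Type) (_ : Nonempty M) (_ : (L.sum (LR n)).Structure M),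
      ¬ M ⊨ φ ∧ ∀ c ∈ relOf L n M, ∀ i < k, (θ i).Realize c := by
    intro k
    obtain ⟨M, hne, hstr, hM⟩ := hcon (Θ k) (onlyPos_foldr_inf _ fun g hg => by
      obtain ⟨i, -, rfl⟩ := List.mem_map.1 hg
      exact (hθi i).1)
    simp only [realize_Θ] at hM
    obtain ⟨hM, c, hc, h⟩ | hM := hM
    · exact (h fun i _ => (hθi i).2 M hM c hc).elim
    · exact ⟨M, hne, hstr, hM⟩
  choose M hne hstr hφ hMθ using key
  let U : Type := ((hyperfilter ℕ : Ultrafilter ℕ) : Filter ℕ).Product M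
  have hUφ : ¬ U ⊨ φ := fun h => by
    obtain ⟨j, hj⟩ := ((Ultraproduct.sentence_realize φ).1 h).exists
    exact hφ j hj
  have hUθ : ∀ c ∈ relOf L n U, ∀ f ∈ posConsequences φ, f.Realize c := by
    intro c hc f hf
    obtain ⟨i, rfl⟩ : f ∈ Set.range θ := hθ ▸ hf
    choose c' hc' using fun i => Quotient.exists_rep (c i)
    obtain rfl : (fun i => Quotient.mk _ (c' i)) = c := funext hc'
    have h1 := (realize_formula_hyperfilter M (relFormula L n) c').1 hc
    have h2 := eventually_hyperfilter_of_forall_lt (p := fun k => ∀ c ∈ relOf L n (M k),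
      (θ i).Realize c) i fun k hk c hc => hMθ k c hc i hk
    exact (realize_formula_hyperfilter M (θ i) c').2 ((h1.and h2).mono fun j hj => hj.2 _ hj.1)
  choose N hneN hstrN hsat hNφ d hdR hd using fun c : relOf L n U =>
    exists_saturated_witness (hUθ c.1 c.2)
  exact hUφ (realize_of_forall_saturated_witness φ hU (countablySaturated_product M) N hsat hNφ d
    hdR hd)

end Compactness

section Translation

variable {L : Language} {n : ℕ}

/-- Translation of terms over `Σ ∪ {R}` to terms over `Σ`, renaming variables. -/
def termToInc {α : Type} (g : α → ℕ) : (L.sum (LR n)).Term α → L.Term ℕ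
  | .var a => .var (g a)
  | .func (Sum.inl f) ts => .func f fun i => termToInc g (ts i)
  | .func (Sum.inr f) _ => Empty.elim f

/-- The variables `0, …, n - 1` encode the free variables and `2 * n + i` the `i`-th bound one;
the variables `n, …, 2 * n - 1` are kept for enumerating `R`. -/
def incVar (n k : ℕ) : Fin n ⊕ Fin k → ℕ :=
  Sum.elim (fun j => j) fun i => 2 * n + i

/-- Translation of a formula (`true`) or its negation (`false`) to inclusion logic. It is correct
if `R` occurs with the given polarity only. -/
def toInc : ∀ {k : ℕ}, (L.sum (LR n)).BoundedFormula (Fin n) k → Bool → IncForm L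
  | _, .falsum, true => .ex 0 (.neq (.var 0) (.var 0))
  | _, .falsum, false => .ex 0 (.eq (.var 0) (.var 0))
  | k, .equal t u, true => .eq (termToInc (incVar n k) t) (termToInc (incVar n k) u)
  | k, .equal t u, false => .neq (termToInc (incVar n k) t) (termToInc (incVar n k) u)
  | k, .rel (Sum.inl r) ts, true => .rel r fun i => termToInc (incVar n k) (ts i)
  | k, .rel (Sum.inl r) ts, false => .nrel r fun i => termToInc (incVar n k) (ts i)
  | k, .rel (Sum.inr r) ts, _ =>
      .incl (fun j : Fin n => termToInc (incVar n k) (ts (Fin.cast r.down.symm j)))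
        fun j : Fin n => .var (n + j)
  | _, .imp f g, true => .or (toInc f false) (toInc g true)
  | _, .imp f g, false => .and (toInc f true) (toInc g false)
  | k, .all f, true => .all (2 * n + k) (toInc f true)
  | k, .all f, false => .ex (2 * n + k) (toInc f false)

theorem tvars_termToInc {k : ℕ} (t : (L.sum (LR n)).Term (Fin n ⊕ Fin k)) :
    tvars (termToInc (incVar n k) t) ⊆ {v | v < 2 * n + k} := by
  induction t with
  | var a =>
    rintro v rfl
    obtain j | i := a
    · exact show (j : ℕ) < 2 * n + k by omega
    · exact show 2 * n + (i : ℕ) < 2 * n + k by omega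
  | func f ts ih =>
    obtain f | f := f
    · exact Set.iUnion_subset ih
    · exact Empty.elim f

theorem fvInc_toInc {k : ℕ} (f : (L.sum (LR n)).BoundedFormula (Fin n) k) (b : Bool) :
    fvInc (toInc f b) ⊆ {v | v < 2 * n + k} := by
  induction f generalizing b with
  | falsum => cases b <;> simp [toInc, fvInc, tvars]
  | equal t u => cases b <;> exact Set.union_subset (tvars_termToInc t) (tvars_termToInc u)
  | rel r ts =>
    obtain r | r := r
    · cases b <;> exact Set.iUnion_subset fun i => tvars_termToInc _
    · have : fvInc (toInc (.rel (Sum.inr r) ts) b) =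
          (⋃ j : Fin n, tvars (termToInc (incVar n _) (ts (Fin.cast r.down.symm j)))) ∪
            ⋃ j : Fin n, {n + (j : ℕ)} := by cases b <;> rfl
      rw [this]
      refine Set.union_subset (Set.iUnion_subset fun i => tvars_termToInc _)
        (Set.iUnion_subset fun j => ?_)
      rintro v rfl
      exact show n + (j : ℕ) < _ by omega
  | imp f g ihf ihg => cases b <;> exact Set.union_subset (ihf _) (ihg _)
  | @all k f ih =>
    have key : ∀ b, fvInc (toInc f b) \ {2 * n + k} ⊆ {v | v < 2 * n + k} := by
      rintro b v ⟨hv, hne⟩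
      have h1 : v < 2 * n + (k + 1) := ih b hv
      have h2 : v ≠ 2 * n + k := hne
      exact show v < 2 * n + k by omega
    cases b <;> exact key _

variable {M : Type}

theorem comp_incVar {k : ℕ} (s : ℕ → M) :
    s ∘ incVar n k = Sum.elim (fun j : Fin n => s j) fun i : Fin k => s (2 * n + i) := by
  funext x
  cases x <;> rfl

/-- Replace the values of the variables `n, …, 2 * n - 1` by `p`. -/
def setBlock (s : ℕ → M) (p : Fin n → M) : ℕ → M := fun v =>
  if h : n ≤ v ∧ v < 2 * n then p ⟨v - n, by omega⟩ else s v

theorem setBlock_block (s : ℕ → M) (p : Fin n → M) (j : Fin n) : setBlock s p (n + j) = p j := by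
  have h : n ≤ n + (j : ℕ) ∧ n + (j : ℕ) < 2 * n := by omega
  simp [setBlock, h]

theorem setBlock_of_notMem (s : ℕ → M) (p : Fin n → M) {v : ℕ} (h : ¬(n ≤ v ∧ v < 2 * n)) :
    setBlock s p v = s v :=
  dif_neg h

theorem setBlock_update (s : ℕ → M) (p : Fin n → M) {v : ℕ} (m : M) (h : ¬(n ≤ v ∧ v < 2 * n)) :
    setBlock (Function.update s v m) p = Function.update (setBlock s p) v m := by
  funext u
  by_cases hu : u = v
  · subst hu
    simp [setBlock, h]
  · simp [setBlock, Function.update_of_ne hu]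

variable [L.Structure M]

section Semantics

variable [(LR n).Structure M]

theorem realize_termToInc {α : Type} (g : α → ℕ) (t : (L.sum (LR n)).Term α) (s : ℕ → M) :
    (termToInc g t).realize s = t.realize (s ∘ g) := by
  induction t with
  | var a => rfl
  | func f ts ih =>
    obtain f | f := f
    · exact congrArg _ (funext ih)
    · exact Empty.elim f

/-- Truth of a formula under an assignment of the variables used in `toInc`. -/
def Holds {k : ℕ} (f : (L.sum (LR n)).BoundedFormula (Fin n) k) (s : ℕ → M) : Prop :=
  f.Realize (fun j : Fin n => s j) fun i : Fin k => s (2 * n + i)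

theorem holds_all {k : ℕ} (f : (L.sum (LR n)).BoundedFormula (Fin n) (k + 1)) (s : ℕ → M) :
    Holds f.all s ↔ ∀ m, Holds f (Function.update s (2 * n + k) m) := by
  refine forall_congr' fun m => ?_
  have h1 : (fun j : Fin n => Function.update s (2 * n + k) m j) = fun j : Fin n => s j :=
    funext fun j => Function.update_of_ne (by omega) _ _
  have h2 : (fun i : Fin (k + 1) => Function.update s (2 * n + k) m (2 * n + i)) =
      Fin.snoc (α := fun _ => M) (fun i : Fin k => s (2 * n + i)) m := by
    funext i
    refine Fin.lastCases ?_ (fun i => ?_) i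
    · simp
    · simp [Function.update_of_ne, i.2.ne]
  rw [Holds, h1, h2]

theorem realize_of_teamSat_toInc {k : ℕ} (f : (L.sum (LR n)).BoundedFormula (Fin n) k) (b : Bool)
    (hf : OnlyPos n f b) (Y : Set (ℕ → M))
    (hY : ∀ t ∈ Y, (fun j : Fin n => t (n + j)) ∈ relOf L n M) (h : teamSat M (toInc f b) Y) :
    ∀ t ∈ Y, (Holds f t ↔ b = true) := by
  induction f generalizing b Y with
  | falsum =>
    intro t ht
    cases b
    · exact ⟨False.elim, Bool.false_ne_true⟩
    · obtain ⟨H, hH, h⟩ := h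
      obtain ⟨m, hm⟩ := hH t ht
      exact (h _ ⟨t, ht, m, hm, rfl⟩ rfl).elim
  | equal t u =>
    intro s hs
    have := h
    cases b <;> simp only [toInc, teamSat, realize_termToInc, comp_incVar] at this
    · exact iff_of_false (this s hs) Bool.false_ne_true
    · exact iff_of_true (this s hs) rfl
  | rel r ts =>
    intro s hs
    have := h
    obtain r | r := r
    · cases b <;> simp only [toInc, teamSat, realize_termToInc, comp_incVar] at this
      · exact iff_of_false (this s hs) Bool.false_ne_true
      · exact iff_of_true (this s hs) rfl
    · obtain rfl : b = true := by rwa [OnlyPos] at hf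
      refine iff_of_true ?_ rfl
      obtain ⟨rfl⟩ := r
      simp only [toInc, teamSat, realize_termToInc, comp_incVar] at this
      obtain ⟨s', hs', h⟩ := this s hs
      have h2 := hY s' hs'
      rw [show (fun j : Fin _ => s' (_ + j)) = _ from (funext h).symm] at h2
      exact h2
  | imp f g ihf ihg =>
    intro t ht
    obtain ⟨h1, h2⟩ := onlyPos_imp.1 hf
    cases b
    · have hf := ihf true h1 Y hY h.1 t ht
      have hg := ihg false h2 Y hY h.2 t ht
      refine iff_of_false (fun h => ?_) Bool.false_ne_true
      exact Bool.false_ne_true (hg.1 (h (hf.2 rfl)))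
    · refine iff_of_true (fun hft => ?_) rfl
      obtain ⟨Y₁, Y₂, rfl, hf, hg⟩ := h
      obtain ht | ht := ht
      · exact absurd ((ihf false h1 Y₁ (fun t ht => hY t (.inl ht)) hf t ht).1 hft) Bool.false_ne_true
      · exact (ihg true h2 Y₂ (fun t ht => hY t (.inr ht)) hg t ht).2 rfl
  | @all k f ih =>
    have hw : ∀ t ∈ Y, ∀ m, (fun j : Fin n => Function.update t (2 * n + k) m (n + j)) ∈
        relOf L n M := by
      intro t ht m
      have : (fun j : Fin n => Function.update t (2 * n + k) m (n + j)) =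
          fun j : Fin n => t (n + j) := funext fun j => Function.update_of_ne (by omega) _ _
      exact this ▸ hY t ht
    intro t ht
    rw [holds_all]
    cases b
    · obtain ⟨H, hH, h⟩ := h
      obtain ⟨m, hm⟩ := hH t ht
      refine iff_of_false (fun h' => ?_) Bool.false_ne_true
      refine Bool.false_ne_true ((ih false (onlyPos_all.1 hf) _ ?_ h _ ⟨t, ht, m, hm, rfl⟩).1 (h' m))
      rintro _ ⟨t, ht, m, -, rfl⟩
      exact hw t ht m
    · refine iff_of_true (fun m => ?_) rfl
      refine (ih true (onlyPos_all.1 hf) _ ?_ h _ ⟨t, ht, m, rfl⟩).2 rfl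
      rintro _ ⟨t, ht, m, rfl⟩
      exact hw t ht m

theorem holds_setBlock {k : ℕ} (f : (L.sum (LR n)).BoundedFormula (Fin n) k) (s : ℕ → M)
    (p : Fin n → M) : Holds f (setBlock s p) ↔ Holds f s := by
  have h1 : (fun j : Fin n => setBlock s p j) = fun j : Fin n => s j :=
    funext fun j => setBlock_of_notMem _ _ (by omega)
  have h2 : (fun i : Fin k => setBlock s p (2 * n + i)) = fun i : Fin k => s (2 * n + i) :=
    funext fun i => setBlock_of_notMem _ _ (by omega)
  rw [Holds, h1, h2, Holds]

theorem teamSat_toInc [Nonempty M] {k : ℕ} (f : (L.sum (LR n)).BoundedFormula (Fin n) k) (b : Bool)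
    (hf : OnlyPos n f b) (Y : Set (ℕ → M))
    (hY : ∀ t ∈ Y, ∀ p ∈ relOf L n M, setBlock t p ∈ Y)
    (h : ∀ t ∈ Y, (Holds f t ↔ b = true)) : teamSat M (toInc f b) Y := by
  induction f generalizing b Y with
  | falsum =>
    cases b
    · exact ⟨fun _ => Set.univ, fun _ _ => Set.univ_nonempty, fun _ _ => rfl⟩
    · have : ∀ t, t ∉ Y := fun t ht => (h t ht).2 rfl
      refine ⟨fun _ => Set.univ, fun _ _ => Set.univ_nonempty, ?_⟩
      rintro _ ⟨t, ht, -⟩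
      exact absurd ht (this t)
  | equal t u =>
    cases b <;> simp only [toInc, teamSat, realize_termToInc, comp_incVar] <;> intro s hs
    · exact fun h' => Bool.false_ne_true ((h s hs).1 h')
    · exact (h s hs).2 rfl
  | rel r ts =>
    obtain r | r := r
    · cases b <;> simp only [toInc, teamSat, realize_termToInc, comp_incVar] <;> intro s hs
      · exact fun h' => Bool.false_ne_true ((h s hs).1 h')
      · exact (h s hs).2 rfl
    · obtain rfl : b = true := by rwa [OnlyPos] at hf
      obtain ⟨rfl⟩ := r
      simp only [toInc, teamSat, realize_termToInc, comp_incVar]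
      intro s hs
      exact ⟨_, hY s hs _ ((h s hs).2 rfl), fun j =>
        (setBlock_block s (fun j => (ts j).realize _) j).symm⟩
  | imp f g ihf ihg =>
    obtain ⟨h1, h2⟩ := onlyPos_imp.1 hf
    cases b
    · have key : ∀ t ∈ Y, Holds f t ∧ ¬ Holds g t := fun t ht => by
        by_contra hcon
        exact Bool.false_ne_true ((h t ht).1 fun hft => by_contra fun hgt => hcon ⟨hft, hgt⟩)
      exact ⟨ihf true h1 Y hY fun t ht => iff_of_true (key t ht).1 rfl,
        ihg false h2 Y hY fun t ht => iff_of_false (key t ht).2 Bool.false_ne_true⟩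
    · refine ⟨{t ∈ Y | ¬ Holds f t}, {t ∈ Y | Holds g t}, ?_, ?_, ?_⟩
      · ext t
        refine ⟨fun ht => ?_, fun ht => ht.elim And.left And.left⟩
        by_cases hft : Holds f t
        · exact .inr ⟨ht, (h t ht).2 rfl hft⟩
        · exact .inl ⟨ht, hft⟩
      · exact ihf false h1 _ (fun t ht p hp => ⟨hY t ht.1 p hp, by rw [holds_setBlock]; exact ht.2⟩)
          fun t ht => iff_of_false ht.2 Bool.false_ne_true
      · exact ihg true h2 _ (fun t ht p hp => ⟨hY t ht.1 p hp, by rw [holds_setBlock]; exact ht.2⟩)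
          fun t ht => iff_of_true ht.2 rfl
  | @all k f ih =>
    have hv : ¬ (n ≤ 2 * n + k ∧ 2 * n + k < 2 * n) := by omega
    simp only [holds_all] at h
    cases b
    · refine ⟨fun t => {m | ¬ Holds f (Function.update t (2 * n + k) m)}, fun t ht => ?_,
        ih false (onlyPos_all.1 hf) _ ?_ ?_⟩
      · by_contra hcon
        exact Bool.false_ne_true ((h t ht).1 fun m => by_contra fun hm => hcon ⟨m, hm⟩)
      · rintro _ ⟨t, ht, m, hm, rfl⟩ p hp
        refine ⟨_, hY t ht p hp, m, fun h' => hm ?_, setBlock_update _ _ _ hv⟩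
        rwa [← setBlock_update _ _ _ hv, holds_setBlock] at h'
      · rintro _ ⟨t, ht, m, hm, rfl⟩
        exact iff_of_false hm Bool.false_ne_true
    · refine ih true (onlyPos_all.1 hf) _ ?_ ?_
      · rintro _ ⟨t, ht, m, rfl⟩ p hp
        exact ⟨_, hY t ht p hp, m, setBlock_update _ _ _ hv⟩
      · rintro _ ⟨t, ht, m, rfl⟩
        exact iff_of_true ((h t ht).2 rfl m) rfl

end Semantics

/-- Existential quantification over a list of variables. -/
def exs (vs : List ℕ) (ψ : IncForm L) : IncForm L :=
  vs.foldr .ex ψ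

theorem fvInc_exs (vs : List ℕ) (ψ : IncForm L) : fvInc (exs vs ψ) = fvInc ψ \ {v | v ∈ vs} := by
  induction vs with
  | nil => simp [exs]
  | cons v vs ih =>
    change fvInc (exs vs ψ) \ {v} = _
    rw [ih]
    ext u
    simp only [Set.mem_sdiff, Set.mem_ofPred_eq, Set.mem_singleton_iff, List.mem_cons]
    tauto

theorem teamSat_exs (vs : List ℕ) (ψ : IncForm L) (X : Set (ℕ → M)) :
    teamSat M (exs vs ψ) X ↔ ∃ Y : Set (ℕ → M), (∀ s ∈ X, ∃ t ∈ Y, ∀ v ∉ vs, t v = s v) ∧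
      (∀ t ∈ Y, ∃ s ∈ X, ∀ v ∉ vs, t v = s v) ∧ teamSat M ψ Y := by
  induction vs generalizing X with
  | nil =>
    refine ⟨fun h => ⟨X, fun s hs => ⟨s, hs, fun _ _ => rfl⟩, fun s hs => ⟨s, hs, fun _ _ => rfl⟩, h⟩,
      ?_⟩
    rintro ⟨Y, h1, h2, h⟩
    obtain rfl : X = Y := by
      ext s
      constructor
      · intro hs
        obtain ⟨t, ht, h⟩ := h1 s hs
        rwa [← show t = s from funext fun v => h v (by simp)]
      · intro ht
        obtain ⟨t, ht, h⟩ := h2 s ht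
        rwa [show s = t from funext fun v => h v (by simp)]
    exact h
  | cons v vs ih =>
    constructor
    · rintro ⟨H, hH, h⟩
      obtain ⟨Y, h1, h2, h⟩ := (ih _).1 h
      refine ⟨Y, fun s hs => ?_, fun t ht => ?_, h⟩
      · obtain ⟨m, hm⟩ := hH s hs
        obtain ⟨t, ht, hst⟩ := h1 _ ⟨s, hs, m, hm, rfl⟩
        refine ⟨t, ht, fun u hu => ?_⟩
        simp only [List.mem_cons, not_or] at hu
        rw [hst u hu.2, Function.update_of_ne hu.1]
      · obtain ⟨_, ⟨s, hs, m, -, rfl⟩, hst⟩ := h2 t ht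
        refine ⟨s, hs, fun u hu => ?_⟩
        simp only [List.mem_cons, not_or] at hu
        rw [hst u hu.2, Function.update_of_ne hu.1]
    · rintro ⟨Y, h1, h2, h⟩
      have key : ∀ s t : ℕ → M, (∀ u ∉ v :: vs, t u = s u) →
          ∀ u ∉ vs, t u = Function.update s v (t v) u := by
        intro s t hst u hu
        by_cases huv : u = v
        · subst huv
          simp
        · rw [Function.update_of_ne huv, hst u (by simp [huv, hu])]
      refine ⟨fun s => {m | ∃ t ∈ Y, (∀ u ∉ v :: vs, t u = s u) ∧ m = t v}, fun s hs => ?_,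
        (ih _).2 ⟨Y, ?_, fun t ht => ?_, h⟩⟩
      · obtain ⟨t, ht, hst⟩ := h1 s hs
        exact ⟨_, t, ht, hst, rfl⟩
      · rintro _ ⟨s, hs, _, ⟨t, ht, hst, rfl⟩, rfl⟩
        exact ⟨t, ht, key s t hst⟩
      · obtain ⟨s, hs, hst⟩ := h2 t ht
        exact ⟨_, ⟨s, hs, _, ⟨t, ht, hst, rfl⟩, rfl⟩, key s t hst⟩

/-- The inclusion logic formula expressing `∀ x̄ (R x̄ → θ)`, where the team encodes `R`. -/
def myopicToInc (θ : (L.sum (LR n)).Formula (Fin n)) : IncForm L :=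
  exs ((List.range n).map (n + ·))
    (.and (.incl (fun j : Fin n => .var (n + j)) fun j : Fin n => .var j) (toInc θ true))

theorem mem_block {v : ℕ} : v ∈ (List.range n).map (n + ·) ↔ n ≤ v ∧ v < 2 * n := by
  simp only [List.mem_map, List.mem_range]
  exact ⟨by rintro ⟨j, hj, rfl⟩; omega, fun h => ⟨v - n, by omega, by omega⟩⟩

theorem fvInc_myopicToInc (θ : (L.sum (LR n)).Formula (Fin n)) :
    fvInc (myopicToInc θ) ⊆ {v | v < n} := by
  rw [myopicToInc, fvInc_exs]
  rintro v ⟨hv, hblock⟩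
  rw [Set.mem_ofPred_eq, mem_block] at hblock
  suffices v < 2 * n from show v < n by omega
  simp only [fvInc, tvars, Set.mem_union, Set.mem_iUnion, Set.mem_singleton_iff] at hv
  obtain (⟨j, rfl⟩ | ⟨j, rfl⟩) | hv := hv
  · omega
  · omega
  · exact fvInc_toInc θ true hv

theorem teamSat_myopicToInc [Nonempty M] {θ : (L.sum (LR n)).Formula (Fin n)}
    (hθ : OnlyPos n θ true) (X : Set (ℕ → M)) :
    letI : (LR n).Structure M := withRel n (teamRel n X)
    teamSat M (myopicToInc θ) X ↔ ∀ c ∈ teamRel n X, θ.Realize c := by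
  let _ : (LR n).Structure M := withRel n (teamRel n X)
  have holds_iff : ∀ t : ℕ → M, Holds θ t ↔ θ.Realize fun j : Fin n => t j := fun t => by
    rw [Holds, Formula.Realize, Subsingleton.elim (fun i : Fin 0 => t (2 * n + i)) default]
  have restrict : ∀ s t : ℕ → M, (∀ v ∉ (List.range n).map (n + ·), t v = s v) →
      (fun j : Fin n => t j) = fun j : Fin n => s j := fun s t h =>
    funext fun j => h j (by rw [mem_block]; omega)
  change _ ↔ ∀ c ∈ teamRel n X, θ.Realize c
  rw [myopicToInc, teamSat_exs]
  constructor
  · rintro ⟨Y, h1, h2, hincl, h⟩ _ ⟨s, hs, rfl⟩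
    obtain ⟨t, ht, hst⟩ := h1 s hs
    rw [← restrict s t hst, ← holds_iff]
    refine (realize_of_teamSat_toInc θ true hθ Y (fun t ht => ?_) h t ht).2 rfl
    obtain ⟨t', ht', htt⟩ := hincl t ht
    obtain ⟨s, hs, hst⟩ := h2 t' ht'
    exact ⟨s, hs, (funext htt).trans (restrict s t' hst)⟩
  · intro h
    let Y : Set (ℕ → M) := {t | (∃ s ∈ X, ∀ v ∉ (List.range n).map (n + ·), t v = s v) ∧
      (fun j : Fin n => t (n + j)) ∈ teamRel n X}
    have mem_Y : ∀ s ∈ X, setBlock s (fun j : Fin n => s j) ∈ Y := fun s hs =>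
      ⟨⟨s, hs, fun v hv => setBlock_of_notMem _ _ (mem_block.not.1 hv)⟩, s, hs,
        funext (setBlock_block s _)⟩
    refine ⟨Y, fun s hs => ⟨_, mem_Y s hs, fun v hv =>
      setBlock_of_notMem _ _ (mem_block.not.1 hv)⟩, fun t ht => ht.1, ?_,
      teamSat_toInc θ true hθ Y ?_ ?_⟩
    · rintro t ⟨-, s, hs, hts⟩
      refine ⟨_, mem_Y s hs, fun j => (congrFun hts j).trans ?_⟩
      exact (setBlock_of_notMem _ _ (by omega)).symm
    · rintro t ⟨⟨s, hs, hst⟩, -⟩ p hp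
      refine ⟨⟨s, hs, fun v hv => ?_⟩, ?_⟩
      · exact (setBlock_of_notMem _ _ (mem_block.not.1 hv)).trans (hst v hv)
      · rw [show (fun j : Fin n => setBlock t p (n + j)) = p from funext (setBlock_block t p)]
        exact hp
    · rintro t ⟨⟨s, hs, hst⟩, -⟩
      refine iff_of_true ((holds_iff t).2 ?_) rfl
      rw [restrict s t hst]
      exact h _ ⟨s, hs, rfl⟩

end Translation

section Sublanguage

variable {L : Language} {n : ℕ}

/-- The sublanguage consisting of the symbols in `S`. -/
def sublanguage (S : Set L.Symbols) : Language :=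
  ⟨fun k => {f : L.Functions k // Sum.inl ⟨k, f⟩ ∈ S},
    fun k => {r : L.Relations k // Sum.inr ⟨k, r⟩ ∈ S}⟩

/-- The inclusion of a sublanguage. -/
def sublanguageIncl (S : Set L.Symbols) : sublanguage S →ᴸ L :=
  ⟨fun _ f => f.1, fun _ r => r.1⟩

theorem sublanguageIncl_injective (S : Set L.Symbols) : (sublanguageIncl S).Injective :=
  ⟨fun h => Subtype.ext h, fun h => Subtype.ext h⟩

/-- The inclusion of a sublanguage expanded by `R`. -/
def sublanguageRelIncl (n : ℕ) (S : Set L.Symbols) : (sublanguage S).sum (LR n) →ᴸ L.sum (LR n) :=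
  (sublanguageIncl S).sumMap (LHom.id (LR n))

theorem countable_symbols_sublanguage {S : Set L.Symbols} (hS : S.Countable) :
    Countable ((sublanguage S).sum (LR n)).Symbols := by
  have := hS.to_subtype
  have h1 : ∀ k, Countable {f : L.Functions k // Sum.inl ⟨k, f⟩ ∈ S} := fun k =>
    Function.Injective.countable (β := S) (f := fun f => ⟨Sum.inl ⟨k, f.1⟩, f.2⟩)
      fun f g h => Subtype.ext (by simpa using h)
  have h2 : ∀ k, Countable {f : L.Relations k // Sum.inr ⟨k, f⟩ ∈ S} := fun k =>
    Function.Injective.countable (β := S) (f := fun f => ⟨Sum.inr ⟨k, f.1⟩, f.2⟩)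
      fun f g h => Subtype.ext (by simpa using h)
  have h3 : ∀ k, Countable (((sublanguage S).sum (LR n)).Functions k) := fun k =>
    inferInstanceAs (Countable ({f : L.Functions k // Sum.inl ⟨k, f⟩ ∈ S} ⊕ Empty))
  have h4 : ∀ k, Countable (((sublanguage S).sum (LR n)).Relations k) := fun k =>
    inferInstanceAs (Countable ({f : L.Relations k // Sum.inr ⟨k, f⟩ ∈ S} ⊕ PLift (k = n)))
  exact inferInstanceAs (Countable (_ ⊕ _))

theorem exists_countable_forall_onTerm {α : Type} (t : (L.sum (LR n)).Term α) :
    ∃ S : Set L.Symbols, S.Countable ∧ ∀ S' ⊇ S, ∃ t', (sublanguageRelIncl n S').onTerm t' = t := by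
  induction t with
  | var a => exact ⟨∅, Set.countable_empty, fun _ _ => ⟨.var a, rfl⟩⟩
  | @func k f ts ih =>
    obtain f | f := f
    · choose S hS h using ih
      refine ⟨insert (Sum.inl ⟨k, f⟩) (⋃ i, S i), (Set.countable_iUnion hS).insert _,
        fun S' hS' => ?_⟩
      choose t' ht' using fun i => h i S'
        ((Set.subset_iUnion S i).trans ((Set.subset_insert _ _).trans hS'))
      refine ⟨.func (Sum.inl ⟨f, hS' (Set.mem_insert _ _)⟩) t', ?_⟩
      exact congrArg (Term.func (L := L.sum (LR n)) (Sum.inl f)) (funext ht')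
    · exact Empty.elim f

theorem exists_countable_forall_onBoundedFormula {α : Type} {k : ℕ}
    (f : (L.sum (LR n)).BoundedFormula α k) :
    ∃ S : Set L.Symbols, S.Countable ∧
      ∀ S' ⊇ S, ∃ f', (sublanguageRelIncl n S').onBoundedFormula f' = f := by
  induction f with
  | falsum => exact ⟨∅, Set.countable_empty, fun _ _ => ⟨.falsum, rfl⟩⟩
  | equal t u =>
    obtain ⟨S, hS, ht⟩ := exists_countable_forall_onTerm t
    obtain ⟨T, hT, hu⟩ := exists_countable_forall_onTerm u
    refine ⟨S ∪ T, hS.union hT, fun S' hS' => ?_⟩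
    obtain ⟨t', rfl⟩ := ht S' (Set.subset_union_left.trans hS')
    obtain ⟨u', rfl⟩ := hu S' (Set.subset_union_right.trans hS')
    exact ⟨.equal t' u', rfl⟩
  | @rel k l r ts =>
    choose S hS h using fun i => exists_countable_forall_onTerm (ts i)
    obtain r | r := r
    · refine ⟨insert (Sum.inr ⟨l, r⟩) (⋃ i, S i), (Set.countable_iUnion hS).insert _,
        fun S' hS' => ?_⟩
      choose t' ht' using fun i => h i S'
        ((Set.subset_iUnion S i).trans ((Set.subset_insert _ _).trans hS'))
      refine ⟨.rel (Sum.inl ⟨r, hS' (Set.mem_insert _ _)⟩) t', ?_⟩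
      exact congrArg (BoundedFormula.rel (L := L.sum (LR n)) (Sum.inl r)) (funext ht')
    · refine ⟨⋃ i, S i, Set.countable_iUnion hS, fun S' hS' => ?_⟩
      choose t' ht' using fun i => h i S' ((Set.subset_iUnion S i).trans hS')
      refine ⟨.rel (Sum.inr r) t', ?_⟩
      exact congrArg (BoundedFormula.rel (L := L.sum (LR n)) (Sum.inr r)) (funext ht')
  | imp f g ihf ihg =>
    obtain ⟨S, hS, hf⟩ := ihf
    obtain ⟨T, hT, hg⟩ := ihg
    refine ⟨S ∪ T, hS.union hT, fun S' hS' => ?_⟩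
    obtain ⟨f', rfl⟩ := hf S' (Set.subset_union_left.trans hS')
    obtain ⟨g', rfl⟩ := hg S' (Set.subset_union_right.trans hS')
    exact ⟨.imp f' g', rfl⟩
  | all f ih =>
    obtain ⟨S, hS, hf⟩ := ih
    refine ⟨S, hS, fun S' hS' => ?_⟩
    obtain ⟨f', rfl⟩ := hf S' hS'
    exact ⟨f'.all, rfl⟩

theorem onlyPos_onBoundedFormula {S : Set L.Symbols} {α : Type} {k : ℕ}
    (f : ((sublanguage S).sum (LR n)).BoundedFormula α k) (b : Bool) (hf : OnlyPos n f b) :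
    OnlyPos n ((sublanguageRelIncl n S).onBoundedFormula f) b := by
  induction f generalizing b with
  | falsum => exact onlyPos_falsum
  | equal t u => rw [LHom.onBoundedFormula, Term.bdEqual, OnlyPos]; trivial
  | rel r ts =>
    obtain r | r := r
    · change OnlyPos n (BoundedFormula.rel (Sum.inl r.1) _) b
      rw [OnlyPos]
      trivial
    · change OnlyPos n (BoundedFormula.rel (Sum.inr r) _) b
      rw [OnlyPos] at hf ⊢
      exact hf
  | imp f g ihf ihg =>
    obtain ⟨h1, h2⟩ := onlyPos_imp.1 hf
    exact onlyPos_imp.2 ⟨ihf _ h1, ihg _ h2⟩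
  | all f ih => exact onlyPos_all.2 (ih _ (onlyPos_all.1 hf))

theorem satR_onSentence {S : Set L.Symbols} {M : Type} [(sublanguage S).Structure M]
    [L.Structure M] [(sublanguageIncl S).IsExpansionOn M] (P : Set (Fin n → M))
    (φ : ((sublanguage S).sum (LR n)).Sentence) :
    satR L n M P ((sublanguageRelIncl n S).onSentence φ) ↔ satR (sublanguage S) n M P φ := by
  let _ : (LR n).Structure M := withRel n P
  have : (sublanguageRelIncl n S).IsExpansionOn M := LHom.sumMap_isExpansionOn _ _ M
  exact LHom.realize_onSentence M (sublanguageRelIncl n S) φ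

/-- A union-closed first-order property of `R` is axiomatised by `∀ x̄ (R x̄ → θ)` for some
formula `θ` in which `R` occurs only positively. -/
theorem exists_onlyPos_satR_iff (φ : (L.sum (LR n)).Sentence)
    (hU : ∀ (M : Type) [Nonempty M] [L.Structure M]
        (ι : Type) (P : ι → Set (Fin n → M)),
        (∀ i, satR L n M (P i) φ) → satR L n M (⋃ i, P i) φ) :
    ∃ θ : (L.sum (LR n)).Formula (Fin n), OnlyPos n θ true ∧
      ∀ (M : Type) [Nonempty M] [L.Structure M] (P : Set (Fin n → M)),
        letI : (LR n).Structure M := withRel n P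
        satR L n M P φ ↔ ∀ c ∈ P, θ.Realize c := by
  classical
  obtain ⟨S, hS, h⟩ := exists_countable_forall_onBoundedFormula φ
  obtain ⟨φ, rfl⟩ := h S subset_rfl
  have := countable_symbols_sublanguage (n := n) hS
  obtain ⟨θ, hθ, h⟩ := exists_onlyPos_iff φ fun M _ _ ι P hP => by
    let _ : Inhabited M := Classical.inhabited_of_nonempty'
    let _ : L.Structure M := (sublanguageIncl S).defaultExpansion M
    have := (sublanguageIncl_injective S).isExpansionOn_default M
    exact (satR_onSentence _ φ).1 (hU M ι P fun i => (satR_onSentence (P i) φ).2 (hP i))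
  refine ⟨(sublanguageRelIncl n S).onFormula θ, onlyPos_onBoundedFormula θ true hθ,
    fun M _ _ P => ?_⟩
  let _ : (sublanguage S).Structure M := (sublanguageIncl S).reduct M
  refine (satR_onSentence P φ).trans ?_
  let _ : (LR n).Structure M := withRel n P
  have : (sublanguageRelIncl n S).IsExpansionOn M := LHom.sumMap_isExpansionOn _ _ M
  refine (h M).trans (forall₂_congr fun c _ => ?_)
  exact (LHom.realize_onFormula (sublanguageRelIncl n S) θ).symm

end Sublanguage

end TeamSem

open TeamSem in
/-- Corollary `FOunion`: let `φ(R)` be a first-order sentence over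
`Σ ∪ {R}` (`R` an `n`-ary relation symbol) defining a union-closed property of `R`.
Then there is an inclusion logic formula `φ⁺(x̄)` over `Σ` with free variables
`x̄ = (x₁,…,xₙ)` (here the variables `0,…,n-1`) such that for all `Σ`-structures `M` and
teams `X` with domain `{x₁,…,xₙ}`: `M ⊨_X φ⁺(x̄)` iff `(M, X(x̄)) ⊨ φ(R)`. -/
theorem union_closed_fo_definable_in_inc {L : Language} (n : ℕ)
    (φ : (L.sum (LR n)).Sentence)
    (hU : ∀ (M : Type) [Nonempty M] [L.Structure M]
        (ι : Type) (P : ι → Set (Fin n → M)),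
        (∀ i, satR L n M (P i) φ) → satR L n M (⋃ i, P i) φ) :
    ∃ φplus : IncForm L, fvInc φplus ⊆ {v : ℕ | v < n} ∧
      ∀ (M : Type) [Nonempty M] [L.Structure M] (X : Set (ℕ → M)),
        teamSat M φplus X ↔ satR L n M (teamRel n X) φ := by
  obtain ⟨θ, hθ, h⟩ := exists_onlyPos_satR_iff φ hU
  exact ⟨myopicToInc θ, fvInc_myopicToInc θ, fun M _ _ X =>
    (teamSat_myopicToInc hθ X).trans (h M (teamRel n X)).symm⟩
end

section
/- Let A and B be structures over the empty signature with |dom(A)| = n and |dom(B)| = n + 1 (e.g., A = {1,…,n} and B = {1,…,n+1}). Then for every Inclusion Logic sentence φ of rank at most n: if A ⊨ φ then B ⊨ φ. -/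
open FirstOrder Language Set

namespace TeamSem

variable {L : Language}

/-- The rank of an inclusion logic formula. -/
def rankInc : IncForm L → ℕ
  | .rel _ _ => 0
  | .nrel _ _ => 0
  | .eq _ _ => 0
  | .neq _ _ => 0
  | .incl _ _ => 0
  | .and φ ψ => max (rankInc φ) (rankInc ψ)
  | .or φ ψ => max (rankInc φ) (rankInc ψ) + 1
  | .ex _ φ => rankInc φ + 1
  | .all _ φ => rankInc φ + 1

end TeamSem

namespace TeamSem

/-- `Y` consists, up to agreement on `V`, of the images of the members of `X` under all
embeddings `A ↪ B`. -/
structure IsLift {A B : Type*} (V : Set ℕ) (X : Set (ℕ → A)) (Y : Set (ℕ → B)) : Prop where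
  exists_of_mem : ∀ t ∈ Y, ∃ s ∈ X, ∃ f : A ↪ B, EqOn t (f ∘ s) V
  exists_mem : ∀ s ∈ X, ∀ f : A ↪ B, ∃ t ∈ Y, EqOn t (f ∘ s) V

section

variable {A B : Type*} {V : Set ℕ} {X : Set (ℕ → A)} {Y : Set (ℕ → B)}

theorem realize_eq_of_eqOn [Language.empty.Structure A] [Language.empty.Structure B]
    (u : Language.empty.Term ℕ) {s : ℕ → A} {t : ℕ → B} {f : A ↪ B}
    (h : EqOn t (f ∘ s) V) (hu : tvars u ⊆ V) : u.realize t = f (u.realize s) := by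
  cases u with
  | var i => exact h (hu rfl)
  | func g _ => exact isEmptyElim g

theorem eqOn_update_insert {s : ℕ → A} {t : ℕ → B} {f g : A → B} (v : ℕ) {a : A} {b : B}
    (h : EqOn t (f ∘ s) V) (hb : b = g a) (hg : ∀ i ∈ V, i ≠ v → g (s i) = f (s i)) :
    EqOn (Function.update t v b) (g ∘ Function.update s v a) (insert v V) := by
  intro i hi
  rcases eq_or_ne i v with rfl | hne
  · simp [hb]
  · have hiV : i ∈ V := hi.resolve_left hne
    simpa [hne, hg i hiV hne] using h hiV

theorem ncard_image_update_insert_le [Finite A] (s : ℕ → A) (v : ℕ) (a : A) :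
    (Function.update s v a '' insert v V).ncard ≤ (s '' V).ncard + 1 := by
  refine (ncard_le_ncard ?_ (toFinite _)).trans (ncard_insert_le a (s '' V))
  rintro _ ⟨i, hi, rfl⟩
  rcases eq_or_ne i v with rfl | hne
  · simp
  · exact Or.inr ⟨i, hi.resolve_left hne, by simp [hne]⟩

theorem IsLift.sep (h : IsLift V X Y) {X' : Set (ℕ → A)} (hX : X' ⊆ X) :
    IsLift V X' {t ∈ Y | ∃ s ∈ X', ∃ f : A ↪ B, EqOn t (f ∘ s) V} where
  exists_of_mem _ ht := ht.2
  exists_mem s hs f := by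
    obtain ⟨t, ht, hst⟩ := h.exists_mem s (hX hs) f
    exact ⟨t, ⟨ht, s, hs, f, hst⟩, hst⟩

theorem IsLift.suppTeam (h : IsLift V X Y) (H : (ℕ → A) → Set A) (v : ℕ) :
    IsLift (insert v V) (suppTeam X H v)
      (suppTeam Y (fun t => {b | ∃ s ∈ X, ∃ f : A ↪ B, EqOn t (f ∘ s) V ∧ b ∈ f '' H s}) v) where
  exists_of_mem := by
    rintro _ ⟨t, -, _, ⟨s, hs, f, hst, m, hm, rfl⟩, rfl⟩
    exact ⟨_, ⟨s, hs, m, hm, rfl⟩, f, eqOn_update_insert v hst rfl fun _ _ _ => rfl⟩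
  exists_mem := by
    rintro _ ⟨s, hs, m, hm, rfl⟩ f
    obtain ⟨t, ht, hst⟩ := h.exists_mem s hs f
    exact ⟨_, ⟨t, ht, f m, ⟨s, hs, f, hst, m, hm, rfl⟩, rfl⟩,
      eqOn_update_insert v hst rfl fun _ _ _ => rfl⟩

theorem IsLift.dupTeam [Finite A] (h : IsLift V X Y)
    (hcard : ∀ s ∈ X, (s '' V).ncard < Nat.card A) (v : ℕ) :
    IsLift (insert v V) (dupTeam A X v) (dupTeam B Y v) where
  exists_of_mem := by
    classical
    rintro _ ⟨t, ht, b, rfl⟩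
    obtain ⟨s, hs, f, hst⟩ := h.exists_of_mem t ht
    by_cases hb : b ∈ range f
    · obtain ⟨a, rfl⟩ := hb
      exact ⟨_, ⟨s, hs, a, rfl⟩, f, eqOn_update_insert v hst rfl fun _ _ _ => rfl⟩
    · obtain ⟨a, ha⟩ : ∃ a, a ∉ s '' V := by
        by_contra! hall
        have := hcard s hs
        rw [eq_univ_of_forall hall, ncard_univ] at this
        exact this.false
      have hinj : Function.Injective (Function.update f a b) := by
        intro x y hxy
        by_cases hx : x = a <;> by_cases hy : y = a <;> simp_all
      refine ⟨_, ⟨s, hs, a, rfl⟩, ⟨_, hinj⟩, eqOn_update_insert v hst (by simp) fun i hi _ => ?_⟩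
      exact Function.update_of_ne (fun e => ha ⟨i, hi, e⟩) _ _
  exists_mem := by
    rintro _ ⟨s, hs, a, rfl⟩ f
    obtain ⟨t, ht, hst⟩ := h.exists_mem s hs f
    exact ⟨_, ⟨t, ht, f a, rfl⟩, eqOn_update_insert v hst rfl fun _ _ _ => rfl⟩

/-- Over the empty signature, satisfaction transfers along lifts of teams, as long as every
assignment leaves at least `rankInc φ` elements of `A` unused. -/
theorem IsLift.teamSat [Finite A] [Language.empty.Structure A] [Language.empty.Structure B]
    {φ : IncForm Language.empty} (h : IsLift V X Y) (hV : fvInc φ ⊆ V)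
    (hcard : ∀ s ∈ X, (s '' V).ncard + rankInc φ ≤ Nat.card A) (hX : teamSat A φ X) :
    teamSat B φ Y := by
  induction φ generalizing V X Y with
  | rel R _ => exact isEmptyElim R
  | nrel R _ => exact isEmptyElim R
  | eq u w =>
    intro t ht
    obtain ⟨s, hs, f, hst⟩ := h.exists_of_mem t ht
    obtain ⟨hu, hw⟩ := union_subset_iff.1 hV
    rw [realize_eq_of_eqOn u hst hu, realize_eq_of_eqOn w hst hw, hX s hs]
  | neq u w =>
    intro t ht
    obtain ⟨s, hs, f, hst⟩ := h.exists_of_mem t ht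
    obtain ⟨hu, hw⟩ := union_subset_iff.1 hV
    rw [realize_eq_of_eqOn u hst hu, realize_eq_of_eqOn w hst hw]
    exact f.injective.ne (hX s hs)
  | incl us ws =>
    intro t ht
    obtain ⟨s, hs, f, hst⟩ := h.exists_of_mem t ht
    obtain ⟨hu, hw⟩ := union_subset_iff.1 hV
    obtain ⟨s', hs', hss⟩ := hX s hs
    obtain ⟨t', ht', hst'⟩ := h.exists_mem s' hs' f
    refine ⟨t', ht', fun i => ?_⟩
    rw [realize_eq_of_eqOn _ hst (iUnion_subset_iff.1 hu i),
      realize_eq_of_eqOn _ hst' (iUnion_subset_iff.1 hw i), hss i]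
  | and φ ψ ihφ ihψ =>
    obtain ⟨hφ, hψ⟩ := union_subset_iff.1 hV
    refine ⟨ihφ h hφ (fun s hs => ?_) hX.1, ihψ h hψ (fun s hs => ?_) hX.2⟩ <;>
    · have := hcard s hs
      simp only [rankInc] at this
      omega
  | or φ ψ ihφ ihψ =>
    obtain ⟨hφ, hψ⟩ := union_subset_iff.1 hV
    obtain ⟨X₁, X₂, rfl, h₁, h₂⟩ := hX
    refine ⟨_, _, ?_, ihφ (h.sep subset_union_left) hφ (fun s hs => ?_) h₁,
      ihψ (h.sep subset_union_right) hψ (fun s hs => ?_) h₂⟩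
    · ext t
      refine ⟨fun ht => ?_, fun ht => ht.elim And.left And.left⟩
      obtain ⟨s, hs, hst⟩ := h.exists_of_mem t ht
      exact hs.imp (fun hs => ⟨ht, s, hs, hst⟩) fun hs => ⟨ht, s, hs, hst⟩
    · have := hcard s (Or.inl hs)
      simp only [rankInc] at this
      omega
    · have := hcard s (Or.inr hs)
      simp only [rankInc] at this
      omega
  | ex v φ ih =>
    obtain ⟨H, hH, hφ⟩ := hX
    refine ⟨_, fun t ht => ?_, ih (h.suppTeam H v) (sdiff_singleton_subset_iff.1 hV) ?_ hφ⟩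
    · obtain ⟨s, hs, f, hst⟩ := h.exists_of_mem t ht
      obtain ⟨m, hm⟩ := hH s hs
      exact ⟨f m, s, hs, f, hst, m, hm, rfl⟩
    · rintro _ ⟨s, hs, m, -, rfl⟩
      have := hcard s hs
      have := ncard_image_update_insert_le (V := V) s v m
      simp only [rankInc] at *
      omega
  | all v φ ih =>
    refine ih (h.dupTeam (fun s hs => ?_) v) (sdiff_singleton_subset_iff.1 hV) ?_ hX
    · have := hcard s hs
      simp only [rankInc] at this
      omega
    · rintro _ ⟨s, hs, m, rfl⟩
      have := hcard s hs
      have := ncard_image_update_insert_le (V := V) s v m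
      simp only [rankInc] at *
      omega

end

end TeamSem

open TeamSem in
/-- Proposition `efex`: let `A` and `B` be structures over the empty
signature with `|dom(A)| = n` and `|dom(B)| = n + 1`. Then for every inclusion logic
sentence `φ` of rank at most `n`: if `A ⊨ φ` then `B ⊨ φ`. -/
theorem small_models_inc_transfer (n : ℕ) (A B : Type*) [Fintype A] [Fintype B]
    [Nonempty A] [Language.empty.Structure A] [Language.empty.Structure B]
    (hA : Fintype.card A = n) (hB : Fintype.card B = n + 1)
    (φ : IncForm Language.empty) (hφ : fvInc φ = ∅) (hrank : rankInc φ ≤ n) :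
    incTrue A φ → incTrue B φ := by
  intro hsat t
  obtain ⟨f⟩ : Nonempty (A ↪ B) := Function.Embedding.nonempty_of_card_le (by omega)
  obtain ⟨a⟩ := ‹Nonempty A›
  have hlift : IsLift ∅ {fun _ : ℕ => a} {t} :=
    ⟨fun _ _ => ⟨_, rfl, f, eqOn_empty _ _⟩, fun _ _ _ => ⟨_, rfl, eqOn_empty _ _⟩⟩
  refine hlift.teamSat hφ.subset (fun s _ => ?_) (hsat _)
  simpa [hA] using hrank
end

section
/- There is no Inclusion Logic sentence φ over the empty signature such that for every finite structure M: M ⊨ φ if and only if |dom(M)| is even. -/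
open FirstOrder Language Set

namespace TeamSem

/-- The assignments `s` and `s'` satisfy the same equalities between variables in `V`. -/
def SameType {M M' : Type*} (V : Set ℕ) (s : ℕ → M) (s' : ℕ → M') : Prop :=
  ∀ i ∈ V, ∀ j ∈ V, (s i = s j ↔ s' i = s' j)

/-- Restricted to `V`, the team `X'` consists of exactly the assignments whose equality type is
realized in `X`. -/
def FullCopy {M M' : Type*} (V : Set ℕ) (X : Set (ℕ → M)) (X' : Set (ℕ → M')) : Prop :=
  (∀ s' ∈ X', ∃ s ∈ X, SameType V s s') ∧
    ∀ s ∈ X, ∀ t' : ℕ → M', SameType V s t' → ∃ s' ∈ X', EqOn s' t' V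

theorem SameType.mono {M M' : Type*} {V W : Set ℕ} {s : ℕ → M} {s' : ℕ → M'} (hWV : W ⊆ V)
    (h : SameType V s s') : SameType W s s' :=
  fun i hi j hj => h i (hWV hi) j (hWV hj)

theorem SameType.symm {M M' : Type*} {V : Set ℕ} {s : ℕ → M} {s' : ℕ → M'}
    (h : SameType V s s') : SameType V s' s :=
  fun i hi j hj => (h i hi j hj).symm

theorem SameType.congr_right {M M' : Type*} {V : Set ℕ} {s : ℕ → M} {s' t' : ℕ → M'}
    (h : SameType V s s') (ht : EqOn s' t' V) : SameType V s t' := by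
  intro i hi j hj
  rw [h i hi j hj, ht hi, ht hj]

/-- A partial assignment over a large enough domain extends to one realizing a given equality
type. -/
theorem exists_sameType_extending {M M' : Type*} [Finite M'] [Nonempty M'] {V : Set ℕ}
    (hV : V.Finite) (hcard : V.ncard ≤ Nat.card M') (r : ℕ → M) {ι : Type*} (u : ι → ℕ)
    (hu : ∀ i, u i ∈ V) (f : ι → M') (hf : ∀ i j, r (u i) = r (u j) ↔ f i = f j) :
    ∃ r' : ℕ → M', (∀ i, r' (u i) = f i) ∧ SameType V r r' := by
  classical
  have := Fintype.ofFinite M'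
  have := (hV.image r).fintype
  let S : Set (r '' V) := {x | ∃ i, r (u i) = x}
  let g : r '' V → M' := fun x => if h : ∃ i, r (u i) = x then f h.choose else Classical.arbitrary M'
  have hg : ∀ i, g ⟨r (u i), mem_image_of_mem r (hu i)⟩ = f i := by
    intro i
    have h : ∃ j, r (u j) = r (u i) := ⟨i, rfl⟩
    simp only [g]
    rw [dif_pos h]
    exact (hf _ _).1 h.choose_spec
  have hinj : InjOn g S.toFinset := by
    rintro ⟨x, hx⟩ hxS ⟨y, hy⟩ hyS hxy
    obtain ⟨i, rfl⟩ : ∃ i, r (u i) = x := by simpa [S] using hxS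
    obtain ⟨j, rfl⟩ : ∃ i, r (u i) = y := by simpa [S] using hyS
    rw [hg, hg] at hxy
    exact Subtype.ext ((hf i j).2 hxy)
  have hle : Fintype.card (r '' V) ≤ Fintype.card M' := by
    rw [← Nat.card_eq_fintype_card, ← Nat.card_eq_fintype_card (α := M')]
    exact (ncard_image_le hV).trans hcard
  obtain ⟨T, hST, -, hT⟩ := Finset.exists_subsuperset_card_eq
    (Finset.subset_univ (S.toFinset.image g))
    (Finset.card_image_le.trans (Finset.card_le_univ _)) hle
  obtain ⟨e, he⟩ := Finset.exists_equiv_extend_of_card_eq hT.symm hST hinj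
  refine ⟨fun n => if h : n ∈ V then (e ⟨r n, mem_image_of_mem r h⟩ : M')
    else Classical.arbitrary M', fun i => ?_, fun i hi j hj => ?_⟩
  · simp only [dif_pos (hu i)]
    rw [he _ (by simp [S]), hg]
  · simp only [dif_pos hi, dif_pos hj]
    rw [← Subtype.ext_iff, e.apply_eq_iff_eq, Subtype.mk.injEq]

theorem SameType.exists_update {M M' : Type*} [Finite M'] [Nonempty M'] {V : Set ℕ}
    (hV : V.Finite) (hcard : V.ncard ≤ Nat.card M') {v : ℕ} {s : ℕ → M} {s' : ℕ → M'}
    (h : SameType (V \ {v}) s s') (m : M) :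
    ∃ m', SameType V (Function.update s v m) (Function.update s' v m') := by
  obtain ⟨r', hr', hT⟩ := exists_sameType_extending hV hcard (Function.update s v m)
    (fun i : ↥(V \ {v}) => (i : ℕ)) (fun i => i.2.1) (fun i => s' i) (by
      rintro ⟨i, hi⟩ ⟨j, hj⟩
      simp only [Function.update_of_ne hi.2, Function.update_of_ne hj.2]
      exact h i hi j hj)
  refine ⟨r' v, hT.congr_right fun i hi => ?_⟩
  by_cases hiv : i = v
  · simp [hiv]
  · rw [Function.update_of_ne hiv]
    exact hr' ⟨i, hi, hiv⟩

theorem FullCopy.mono {M M' : Type*} [Finite M'] [Nonempty M'] {V W : Set ℕ}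
    (hV : V.Finite) (hcard : V.ncard ≤ Nat.card M') (hWV : W ⊆ V)
    {X : Set (ℕ → M)} {X' : Set (ℕ → M')} (h : FullCopy V X X') : FullCopy W X X' := by
  refine ⟨fun s' hs' => ?_, fun s hs t' ht' => ?_⟩
  · obtain ⟨s, hs, hT⟩ := h.1 s' hs'
    exact ⟨s, hs, hT.mono hWV⟩
  · obtain ⟨r', hr', hT⟩ := exists_sameType_extending hV hcard s (fun i : W => (i : ℕ))
      (fun i => hWV i.2) (fun i => t' i) (fun i j => ht' i i.2 j j.2)
    obtain ⟨s', hs', he⟩ := h.2 s hs r' hT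
    exact ⟨s', hs', fun i hi => (he (hWV hi)).trans (hr' ⟨i, hi⟩)⟩

theorem FullCopy.sep {M M' : Type*} {V : Set ℕ} {X Y : Set (ℕ → M)} {X' : Set (ℕ → M')}
    (h : FullCopy V X X') (hYX : Y ⊆ X) :
    FullCopy V Y {s' ∈ X' | ∃ s ∈ Y, SameType V s s'} := by
  refine ⟨fun s' hs' => hs'.2, fun s hs t' ht' => ?_⟩
  obtain ⟨s', hs', he⟩ := h.2 s (hYX hs) t' ht'
  exact ⟨s', ⟨hs', s, hs, ht'.congr_right he.symm⟩, he⟩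

theorem FullCopy.exists_update_eqOn {M M' : Type*} {V : Set ℕ} {v : ℕ} {X : Set (ℕ → M)}
    {X' : Set (ℕ → M')} (h : FullCopy (V \ {v}) X X') {s : ℕ → M} (hs : s ∈ X) {m : M}
    {t' : ℕ → M'} (ht' : SameType V (Function.update s v m) t') :
    ∃ s' ∈ X', EqOn (Function.update s' v (t' v)) t' V := by
  obtain ⟨s', hs', he⟩ := h.2 s hs t' fun i hi j hj => by
    simpa only [Function.update_of_ne hi.2, Function.update_of_ne hj.2]
      using ht' i hi.1 j hj.1
  refine ⟨s', hs', fun i hi => ?_⟩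
  by_cases hiv : i = v
  · simp [hiv]
  · rw [Function.update_of_ne hiv]
    exact he ⟨hi, hiv⟩

theorem exists_eq_var (t : Language.empty.Term ℕ) : ∃ v, t = Term.var v := by
  cases t with
  | var v => exact ⟨v, rfl⟩
  | func f _ => exact isEmptyElim f

theorem finite_tvars (t : Language.empty.Term ℕ) : (tvars t).Finite := by
  obtain ⟨v, rfl⟩ := exists_eq_var t
  simp [tvars]

theorem finite_fvInc (φ : IncForm Language.empty) : (fvInc φ).Finite := by
  induction φ with
  | rel R | nrel R => exact isEmptyElim R
  | eq t u | neq t u => exact (finite_tvars t).union (finite_tvars u)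
  | incl ts us =>
    exact (finite_iUnion fun i => finite_tvars (ts i)).union
      (finite_iUnion fun i => finite_tvars (us i))
  | and φ ψ hφ hψ | or φ ψ hφ hψ => exact hφ.union hψ
  | ex v φ hφ | all v φ hφ => exact hφ.sdiff

/-- Over large enough finite domains, satisfaction passes to full copies of teams. -/
theorem exists_card_teamSat_of_fullCopy (φ : IncForm Language.empty) :
    ∃ N : ℕ, ∀ (M M' : Type) [Finite M] [Finite M'] [Nonempty M] [Nonempty M']
      [Language.empty.Structure M] [Language.empty.Structure M'],
      N ≤ Nat.card M → N ≤ Nat.card M' → ∀ (X : Set (ℕ → M)) (X' : Set (ℕ → M')),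
      FullCopy (fvInc φ) X X' → teamSat M φ X → teamSat M' φ X' := by
  induction φ with
  | rel R | nrel R => exact isEmptyElim R
  | eq t u =>
    obtain ⟨v, rfl⟩ := exists_eq_var t
    obtain ⟨w, rfl⟩ := exists_eq_var u
    refine ⟨0, fun M M' _ _ _ _ _ _ _ _ X X' h hX s' hs' => ?_⟩
    obtain ⟨s, hs, hT⟩ := h.1 s' hs'
    exact (hT v (by simp [fvInc, tvars]) w (by simp [fvInc, tvars])).1 (hX s hs)
  | neq t u =>
    obtain ⟨v, rfl⟩ := exists_eq_var t
    obtain ⟨w, rfl⟩ := exists_eq_var u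
    refine ⟨0, fun M M' _ _ _ _ _ _ _ _ X X' h hX s' hs' => ?_⟩
    obtain ⟨s, hs, hT⟩ := h.1 s' hs'
    exact fun he => hX s hs
      ((hT v (by simp [fvInc, tvars]) w (by simp [fvInc, tvars])).2 he)
  | incl ts us =>
    have hfin := finite_fvInc (.incl ts us)
    refine ⟨(fvInc (.incl ts us)).ncard, fun M M' _ _ _ _ _ _ _ hM' X X' h hX s' hs' => ?_⟩
    choose a ha using fun i => exists_eq_var (ts i)
    choose b hb using fun i => exists_eq_var (us i)
    obtain rfl : ts = fun i => Term.var (a i) := funext ha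
    obtain rfl : us = fun i => Term.var (b i) := funext hb
    have haV : ∀ i, a i ∈ fvInc (.incl (L := Language.empty)
        (fun i => Term.var (a i)) fun i => Term.var (b i)) := fun i => by simp [fvInc, tvars]
    have hbV : ∀ i, b i ∈ fvInc (.incl (L := Language.empty)
        (fun i => Term.var (a i)) fun i => Term.var (b i)) := fun i => by simp [fvInc, tvars]
    obtain ⟨s, hs, hT⟩ := h.1 s' hs'
    obtain ⟨r, hr, hsr⟩ := hX s hs
    simp only [Term.realize_var] at hsr ⊢
    obtain ⟨r', hr', hT'⟩ := exists_sameType_extending hfin hM' r b hbV (fun i => s' (a i))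
      (fun i j => by rw [← hsr, ← hsr]; exact hT _ (haV i) _ (haV j))
    obtain ⟨t', ht', he⟩ := h.2 r hr r' hT'
    exact ⟨t', ht', fun i => by rw [he (hbV i), hr']⟩
  | and φ ψ hφ hψ =>
    obtain ⟨N₁, h₁⟩ := hφ
    obtain ⟨N₂, h₂⟩ := hψ
    have hfin := finite_fvInc (.and φ ψ)
    refine ⟨N₁ + N₂ + (fvInc (.and φ ψ)).ncard,
      fun M M' _ _ _ _ _ _ hM hM' X X' h hX => ⟨?_, ?_⟩⟩
    · exact h₁ M M' (by omega) (by omega) X X'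
        (h.mono hfin (by omega) subset_union_left) hX.1
    · exact h₂ M M' (by omega) (by omega) X X'
        (h.mono hfin (by omega) subset_union_right) hX.2
  | or φ ψ hφ hψ =>
    obtain ⟨N₁, h₁⟩ := hφ
    obtain ⟨N₂, h₂⟩ := hψ
    have hfin := finite_fvInc (.or φ ψ)
    refine ⟨N₁ + N₂ + (fvInc (.or φ ψ)).ncard, fun M M' _ _ _ _ _ _ hM hM' X X' h hX => ?_⟩
    obtain ⟨Y, Z, rfl, hY, hZ⟩ := hX
    refine ⟨_, _, ?_, h₁ M M' (by omega) (by omega) Y _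
      ((h.sep subset_union_left).mono hfin (by omega) subset_union_left) hY,
      h₂ M M' (by omega) (by omega) Z _
      ((h.sep subset_union_right).mono hfin (by omega) subset_union_right) hZ⟩
    ext s'
    constructor
    · intro hs'
      obtain ⟨s, hs | hs, hT⟩ := h.1 s' hs'
      · exact .inl ⟨hs', s, hs, hT⟩
      · exact .inr ⟨hs', s, hs, hT⟩
    · rintro (hs' | hs') <;> exact hs'.1
  | ex v φ hφ =>
    obtain ⟨N, hN⟩ := hφ
    have hfin := finite_fvInc φ
    refine ⟨N + (fvInc φ).ncard, fun M M' _ _ _ _ _ _ hM hM' X X' h hX => ?_⟩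
    obtain ⟨H, hH, hX⟩ := hX
    refine ⟨fun s' => {m' | ∃ s ∈ X, ∃ m ∈ H s,
      SameType (fvInc φ) (Function.update s v m) (Function.update s' v m')}, fun s' hs' => ?_,
      hN M M' (by omega) (by omega) _ _ ⟨?_, ?_⟩ hX⟩
    · obtain ⟨s, hs, hT⟩ := h.1 s' hs'
      obtain ⟨m, hm⟩ := hH s hs
      obtain ⟨m', hm'⟩ := SameType.exists_update hfin (by omega) hT m
      exact ⟨m', s, hs, m, hm, hm'⟩
    · rintro _ ⟨s', -, m', ⟨s, hs, m, hm, hT⟩, rfl⟩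
      exact ⟨_, ⟨s, hs, m, hm, rfl⟩, hT⟩
    · rintro _ ⟨s, hs, m, hm, rfl⟩ t' ht'
      obtain ⟨s', hs', he⟩ := h.exists_update_eqOn hs ht'
      exact ⟨_, ⟨s', hs', t' v, ⟨s, hs, m, hm, ht'.congr_right he.symm⟩, rfl⟩, he⟩
  | all v φ hφ =>
    obtain ⟨N, hN⟩ := hφ
    have hfin := finite_fvInc φ
    refine ⟨N + (fvInc φ).ncard, fun M M' _ _ _ _ _ _ hM hM' X X' h hX =>
      hN M M' (by omega) (by omega) _ _ ⟨?_, ?_⟩ hX⟩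
    · rintro _ ⟨s', hs', m', rfl⟩
      obtain ⟨s, hs, hT⟩ := h.1 s' hs'
      obtain ⟨m, hm⟩ := SameType.exists_update hfin (by omega) hT.symm m'
      exact ⟨_, ⟨s, hs, m, rfl⟩, hm.symm⟩
    · rintro _ ⟨s, hs, m, rfl⟩ t' ht'
      obtain ⟨s', hs', he⟩ := h.exists_update_eqOn hs ht'
      exact ⟨_, ⟨s', hs', t' v, rfl⟩, he⟩

theorem exists_card_incTrue_imp (φ : IncForm Language.empty) (hφ : fvInc φ = ∅) :
    ∃ N : ℕ, ∀ (M M' : Type) [Finite M] [Finite M'] [Nonempty M] [Nonempty M']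
      [Language.empty.Structure M] [Language.empty.Structure M'],
      N ≤ Nat.card M → N ≤ Nat.card M' → incTrue M φ → incTrue M' φ := by
  obtain ⟨N, hN⟩ := exists_card_teamSat_of_fullCopy φ
  refine ⟨N, fun M M' _ _ _ _ _ _ hM hM' h s' => ?_⟩
  refine hN M M' hM hM' {fun _ => Classical.arbitrary M} {s'} ?_ (h _)
  simp [FullCopy, SameType, hφ]

end TeamSem

open TeamSem in
/-- there is no inclusion logic sentence `φ` over the empty signature
such that for every finite structure `M`: `M ⊨ φ` iff `|dom(M)|` is even. -/
theorem even_cardinality_not_inc_definable :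
    ¬ ∃ φ : IncForm Language.empty, fvInc φ = ∅ ∧
        ∀ (M : Type) [Fintype M] [Nonempty M] [Language.empty.Structure M],
          incTrue M φ ↔ Even (Fintype.card M) := by
  rintro ⟨φ, hfv, h⟩
  let (n : ℕ) : Language.empty.Structure (Fin n) := Language.emptyStructure
  obtain ⟨N, hN⟩ := exists_card_incTrue_imp φ hfv
  have h₁ := h (Fin (N + 1))
  have h₂ := h (Fin (N + 2))
  have h₁₂ : incTrue (Fin (N + 1)) φ ↔ incTrue (Fin (N + 2)) φ :=
    ⟨hN _ _ (by simp) (by simp), hN _ _ (by simp) (by simp)⟩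
  rw [h₁, h₂, Fintype.card_fin, Fintype.card_fin, Nat.even_add_one (n := N + 1)] at h₁₂
  tauto
end

section
/- Let 𝓡 be the generalized atom with semantics: M ⊨_X 𝓡(x y z w) iff there exist functions f, g : dom(M) → dom(M) such that (a, f(a), b, g(b)) ∈ X(x,y,z,w) for all a, b ∈ dom(M). Then for every finite structure M over the empty signature: M satisfies the sentence ∀x ∃y ∀z ∃w (𝓡(xyzw) ∧ (x = z ↔ y = w) ∧ (y = z → x = w) ∧ x ≠ y), evaluated in lax team semantics, if and only if |dom(M)| is even. -/
namespace RAtomLogic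

/-- Formulas of FO(𝓡) over the empty signature, in negation normal form, with
variables from `ℕ`: equality literals, the generalized atom `𝓡`, and the team-semantic
connectives and quantifiers. -/
inductive RForm where
  | eq (x y : ℕ)
  | neq (x y : ℕ)
  | Ratom (x y z w : ℕ)
  | and (φ ψ : RForm)
  | or (φ ψ : RForm)
  | ex (v : ℕ) (φ : RForm)
  | all (v : ℕ) (φ : RForm)

/-- Lax team semantics for FO(𝓡) over the empty signature.  The atom `𝓡(x y z w)` holds
in a team `X` iff there are `f, g : M → M` with `(a, f a, b, g b) ∈ X(x,y,z,w)` for all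
`a, b ∈ M`. -/
def rSat (M : Type*) : RForm → Set (ℕ → M) → Prop
  | .eq x y, X => ∀ s ∈ X, s x = s y
  | .neq x y, X => ∀ s ∈ X, s x ≠ s y
  | .Ratom x y z w, X => ∃ f g : M → M, ∀ a b : M,
      ∃ s ∈ X, s x = a ∧ s y = f a ∧ s z = b ∧ s w = g b
  | .and φ ψ, X => rSat M φ X ∧ rSat M ψ X
  | .or φ ψ, X => ∃ Y Z, X = Y ∪ Z ∧ rSat M φ Y ∧ rSat M ψ Z
  | .ex v φ, X => ∃ H : (ℕ → M) → Set M, (∀ s ∈ X, (H s).Nonempty) ∧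
      rSat M φ {t | ∃ s ∈ X, ∃ m ∈ H s, t = Function.update s v m}
  | .all v φ, X => rSat M φ {t | ∃ s ∈ X, ∃ m : M, t = Function.update s v m}

/-- Truth of an FO(𝓡) sentence in `M`. -/
def rTrue (M : Type*) (φ : RForm) : Prop := ∀ s : ℕ → M, rSat M φ {s}

/-- The sentence `∀x ∃y ∀z ∃w (𝓡(xyzw) ∧ (x = z ↔ y = w) ∧ (y = z → x = w) ∧ x ≠ y)`,
with `x, y, z, w` the variables `0, 1, 2, 3`, and with `↔` and `→` spelled out in
negation normal form: `(x = z ↔ y = w)` is `(x ≠ z ∨ y = w) ∧ (y ≠ w ∨ x = z)` and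
`(y = z → x = w)` is `(y ≠ z ∨ x = w)`. -/
def evenSentence : RForm :=
  .all 0 (.ex 1 (.all 2 (.ex 3
    (.and (.Ratom 0 1 2 3)
      (.and (.and (.or (.neq 0 2) (.eq 1 3)) (.or (.neq 1 3) (.eq 0 2)))
        (.and (.or (.neq 1 2) (.eq 0 3))
          (.neq 0 1)))))))

end RAtomLogic

namespace RAtomLogic

/-- A disjunction `a ≠ b ∨ c = d` of literals is flat. -/
theorem rSat_neq_or_eq {M : Type*} {a b c d : ℕ} {X : Set (ℕ → M)} :
    rSat M (.or (.neq a b) (.eq c d)) X ↔ ∀ s ∈ X, s a = s b → s c = s d := by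
  simp only [rSat]
  constructor
  · rintro ⟨Y, Z, rfl, hY, hZ⟩ s (hs | hs) h
    · exact absurd h (hY s hs)
    · exact hZ s hs
  · intro h
    refine ⟨{s ∈ X | s a ≠ s b}, {s ∈ X | s a = s b}, ?_, fun s hs => hs.2,
      fun s hs => h s hs.1 hs.2⟩
    ext s
    simp only [Set.mem_union, Set.mem_ofPred_eq]
    tauto

theorem even_card_of_involutive_of_ne {M : Type*} [Fintype M] {f : M → M}
    (hf : Function.Involutive f) (hne : ∀ a, f a ≠ a) : Even (Fintype.card M) := by
  have h : ∑ _a : M, (1 : ZMod 2) = 0 :=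
    Finset.sum_involution (fun a _ => f a) (fun _ _ => by decide) (fun a _ _ => hne a)
      (fun a _ => Finset.mem_univ _) (fun a _ => hf a)
  rw [← ZMod.natCast_eq_zero_iff_even]
  simpa using h

theorem exists_involutive_ne_of_even_card {M : Type*} [Fintype M]
    (h : Even (Fintype.card M)) : ∃ f : M → M, Function.Involutive f ∧ ∀ a, f a ≠ a := by
  obtain ⟨n, hn⟩ := h
  have e : M ≃ Fin n ⊕ Fin n := Fintype.equivOfCardEq (by simp [hn])
  refine ⟨fun a => e.symm (e a).swap, fun a => by simp, fun a ha => ?_⟩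
  have hswap : (e a).swap = e a := by simpa [Equiv.symm_apply_eq] using ha
  cases hx : e a <;> simp [hx] at hswap

/-- `evenSentence` is true iff `M` carries a fixed-point-free involution.  If `M` is empty, this
is the empty function. -/
theorem rTrue_evenSentence_iff {M : Type*} :
    rTrue M evenSentence ↔ ∃ f : M → M, Function.Involutive f ∧ ∀ a, f a ≠ a := by
  constructor
  · intro h
    rcases isEmpty_or_nonempty M with hM | ⟨⟨m⟩⟩
    · exact ⟨id, fun a => hM.elim a, fun a => hM.elim a⟩
    · obtain ⟨H, -, K, -, ⟨f, g, hfg⟩, ⟨hxz, -⟩, hyz, hne⟩ := h fun _ => m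
      rw [rSat_neq_or_eq] at hxz hyz
      have hg : ∀ a, f a = g a := fun a => by
        obtain ⟨s, hs, h0, h1, h2, h3⟩ := hfg a a
        rw [← h1, ← h3]
        exact hxz s hs (h0.trans h2.symm)
      refine ⟨f, fun a => ?_, fun a => ?_⟩
      · obtain ⟨s, hs, h0, h1, h2, h3⟩ := hfg a (f a)
        rw [hg (f a), ← h3, ← hyz s hs (h1.trans h2.symm), h0]
      · obtain ⟨s, hs, h0, h1, -, -⟩ := hfg a a
        rw [← h1, ← h0]
        exact (hne s hs).symm
  · rintro ⟨f, hf, hne⟩ s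
    refine ⟨fun t => {f (t 0)}, fun _ _ => Set.singleton_nonempty _,
      fun t => {f (t 2)}, fun _ _ => Set.singleton_nonempty _, ⟨f, f, fun a b => ?_⟩,
      ⟨rSat_neq_or_eq.2 ?_, rSat_neq_or_eq.2 ?_⟩, rSat_neq_or_eq.2 ?_, ?_⟩
    · exact ⟨_, ⟨_, ⟨_, ⟨_, ⟨s, rfl, a, rfl⟩, _, rfl, rfl⟩, b, rfl⟩, _, rfl, rfl⟩, by simp⟩
    all_goals
      rintro _ ⟨_, ⟨_, ⟨_, ⟨_, -, a, rfl⟩, _, rfl, rfl⟩, b, rfl⟩, _, rfl, rfl⟩ h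
      simp at h ⊢
    · rw [h]
    · exact hf.injective h
    · rw [← h, hf]
    · exact hne a h.symm

end RAtomLogic

open RAtomLogic in
/-- a finite structure `M` over the empty signature satisfies the
FO(𝓡) sentence `∀x∃y∀z∃w(𝓡(xyzw) ∧ (x = z ↔ y = w) ∧ (y = z → x = w) ∧ x ≠ y)`
(in lax team semantics) iff `|dom(M)|` is even. -/
theorem evenSentence_iff_even_card (M : Type*) [Fintype M] :
    rTrue M evenSentence ↔ Even (Fintype.card M) := by
  rw [rTrue_evenSentence_iff]
  exact ⟨fun ⟨_, hf, hne⟩ => even_card_of_involutive_of_ne hf hne,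
    exists_involutive_ne_of_even_card⟩
end
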